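/- arXiv:1503.05612 — 2 statements merged into one kernel-verified Lean document; each statement's English description precedes it below -/
import Mathlib

section
/- Let n and t = t(n) be positive integers, let d = d(n) ≥ 2 be an integer, and let ε = ε(n) < 1/(2d). If p = p(n) satisfies p(n) / (ε(n)^{−1} t(n) n^{−1/d} (log n)^2) → ∞ as n → ∞, then the probability that G(n, p(n)) contains every graph of the family F(n, t, ε, d) as a subgraph tends to 1 as n → ∞. -/
open Finset Filter Real
open scoped Classical

/-- Number of edges of a graph. -/
noncomputable def edgeCount {α : Type*} (G : SimpleGraph α) : ℕ := Nat.card G.edgeSet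

/-- The probability that the binomial random graph `G(n,p)` satisfies the property `P`. -/
noncomputable def gnpProb (n : ℕ) (p : ℝ) (P : SimpleGraph (Fin n) → Prop) : ℝ :=
  ∑ G : SimpleGraph (Fin n),
    if P G then p ^ edgeCount G * (1 - p) ^ (n.choose 2 - edgeCount G) else 0

/-- `G` contains a (not necessarily induced) copy of `H`. -/
def containsCopy {α β : Type*} (G : SimpleGraph α) (H : SimpleGraph β) : Prop :=
  ∃ f : β → α, Function.Injective f ∧ ∀ a b, H.Adj a b → G.Adj (f a) (f b)

/-- `S` is a `k`-independent set in `H`: every two distinct vertices of `S` are at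
graph distance at least `k + 1` (in particular, vertices in different components are
at infinite distance, so the condition holds for them vacuously). -/
def kIndepSet {β : Type*} (H : SimpleGraph β) (k : ℕ) (S : Set β) : Prop :=
  ∀ u ∈ S, ∀ v ∈ S, u ≠ v → ∀ w : H.Walk u v, k + 1 ≤ w.length

/-- Membership in the family `𝓕(n, t, ε, d)`: there is a partition
`W 0, W 1, …, W t` of the vertex set (parts may be empty) with
(i) `|W t| = ⌊ε n⌋`, (ii) `W 0` is the external neighborhood of `W t`,
(iii) `W t` is 3-independent, (iv) `W i` is 2-independent for `1 ≤ i ≤ t - 1`, and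
(v) for `1 ≤ i ≤ t`, each `w ∈ W i` has at most `d` neighbors in `W 0 ∪ ⋯ ∪ W (i-1)`. -/
def inFamilyF (n t d : ℕ) (ε : ℝ) (H : SimpleGraph (Fin n)) : Prop :=
  ∃ W : ℕ → Set (Fin n),
    (∀ i ≤ t, ∀ j ≤ t, i ≠ j → Disjoint (W i) (W j)) ∧
    (⋃ i ∈ Finset.range (t + 1), W i) = Set.univ ∧
    Nat.card (W t) = ⌊ε * n⌋₊ ∧
    W 0 = {v | v ∉ W t ∧ ∃ u ∈ W t, H.Adj u v} ∧
    kIndepSet H 3 (W t) ∧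
    (∀ i, 1 ≤ i → i ≤ t - 1 → kIndepSet H 2 (W i)) ∧
    (∀ i, 1 ≤ i → i ≤ t → ∀ w ∈ W i,
      Nat.card {v | H.Adj w v ∧ ∃ j < i, v ∈ W j} ≤ d)

/-! ### Product Bernoulli weights -/

/-- Weight of a single coordinate. -/
noncomputable def bw (q : ℝ) (b : Bool) : ℝ := if b then q else 1 - q

/-- Product weight. -/
noncomputable def pw {E : Type} [Fintype E] (q : ℝ) (x : E → Bool) : ℝ := ∏ e, bw q (x e)

/-- Probability of an event in the product space. -/
noncomputable def Pr {E : Type} [Fintype E] (q : ℝ) (A : (E → Bool) → Prop) : ℝ :=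
  ∑ x : E → Bool, if A x then pw q x else 0

section prob
variable {E : Type} [Fintype E]

lemma bw_nonneg {q : ℝ} (h0 : 0 ≤ q) (h1 : q ≤ 1) (b : Bool) : 0 ≤ bw q b := by
  unfold bw; split_ifs <;> linarith

lemma pw_nonneg {q : ℝ} (h0 : 0 ≤ q) (h1 : q ≤ 1) (x : E → Bool) : 0 ≤ pw q x :=
  Finset.prod_nonneg fun e _ => bw_nonneg h0 h1 _

lemma sum_pw_prod (q : ℝ) (g : E → Bool → ℝ) :
    ∑ x : E → Bool, pw q x * ∏ e, g e (x e) = ∏ e, ∑ b : Bool, bw q b * g e b := by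
  rw [Finset.prod_univ_sum]
  simp only [pw, Fintype.piFinset_univ, Finset.prod_mul_distrib]

lemma sum_pw (q : ℝ) : ∑ x : E → Bool, pw q x = 1 := by
  have := sum_pw_prod (E := E) q (fun _ _ => 1)
  simpa [bw] using this

lemma sum_pw_all (q : ℝ) (U : Finset E) :
    ∑ x : E → Bool, pw q x * (if ∀ e ∈ U, x e = true then 1 else 0) = q ^ U.card := by
  have := sum_pw_prod (E := E) q (fun e b => if e ∈ U then (if b then 1 else 0) else 1)
  have h2 : ∀ x : E → Bool, (∏ e, (if e ∈ U then (if x e then (1:ℝ) else 0) else 1))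
      = if ∀ e ∈ U, x e = true then 1 else 0 := by
    intro x
    rw [Finset.prod_ite_mem, Finset.univ_inter]
    rw [Finset.prod_ite_zero]
    simp
  simp only [h2] at this
  rw [this]
  have h3 : ∀ e : E, (∑ b : Bool, bw q b * (if e ∈ U then (if b then (1:ℝ) else 0) else 1))
      = if e ∈ U then q else 1 := by
    intro e
    by_cases h : e ∈ U <;> simp [h, bw]
  simp only [h3]
  rw [Finset.prod_ite_mem, Finset.univ_inter, Finset.prod_const]

lemma sum_pw_indep {ι : Type*} (q : ℝ) (I : Finset ι) (T : ι → Finset E)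
    (hT : (I : Set ι).PairwiseDisjoint T) :
    ∑ x : E → Bool, pw q x * ∏ i ∈ I, (1 - if ∀ e ∈ T i, x e = true then (1:ℝ) else 0)
      = ∏ i ∈ I, (1 - q ^ (T i).card) := by
  have key : ∀ (X : ι → ℝ), ∏ i ∈ I, (1 - X i)
      = ∑ J ∈ I.powerset, (-1) ^ J.card * ∏ i ∈ J, X i := by
    intro X
    have : ∀ i ∈ I, 1 - X i = (-1) * X i + 1 := fun i _ => by ring
    rw [Finset.prod_congr rfl this, Finset.prod_add]
    simp
    refine Finset.sum_congr rfl fun J _ => ?_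
    rw [Finset.prod_neg]
  simp only [key, Finset.mul_sum]
  rw [Finset.sum_comm]
  refine Finset.sum_congr rfl fun J hJ => ?_
  have hJ' : (J : Set ι).PairwiseDisjoint T := hT.subset (by simpa using hJ)
  have h1 := sum_pw_all q (J.biUnion T)
  rw [Finset.card_biUnion hJ', ← Finset.prod_pow_eq_pow_sum] at h1
  rw [← h1, Finset.mul_sum]
  refine Finset.sum_congr rfl fun x _ => ?_
  rw [Finset.prod_ite_zero]
  simp only [Finset.mem_biUnion, Finset.prod_const_one]
  have : (∀ i ∈ J, ∀ e ∈ T i, x e = true) ↔ (∀ e, (∃ i ∈ J, e ∈ T i) → x e = true) := by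
    constructor
    · rintro h e ⟨i, hi, he⟩; exact h i hi e he
    · intro h i hi e he; exact h e ⟨i, hi, he⟩
  simp only [this]
  ring

lemma Pr_mono {q : ℝ} (h0 : 0 ≤ q) (h1 : q ≤ 1) {A B : (E → Bool) → Prop}
    (h : ∀ x, A x → B x) : Pr q A ≤ Pr q B := by
  refine Finset.sum_le_sum fun x _ => ?_
  have := pw_nonneg h0 h1 x
  by_cases hA : A x
  · simp [hA, h x hA]
  · simp only [hA, if_false]; split_ifs <;> simp [this]

lemma Pr_compl (q : ℝ) (A : (E → Bool) → Prop) : Pr q A + Pr q (fun x => ¬ A x) = 1 := by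
  rw [← sum_pw (E := E) q, Pr, Pr, ← Finset.sum_add_distrib]
  refine Finset.sum_congr rfl fun x _ => ?_
  by_cases hA : A x <;> simp [hA]

lemma Pr_nonneg {q : ℝ} (h0 : 0 ≤ q) (h1 : q ≤ 1) (A : (E → Bool) → Prop) : 0 ≤ Pr q A := by
  refine Finset.sum_nonneg fun x _ => ?_
  have := pw_nonneg h0 h1 x
  split_ifs <;> simp [this]

lemma Pr_union {ι : Type*} {q : ℝ} (h0 : 0 ≤ q) (h1 : q ≤ 1) (I : Finset ι)
    (A : ι → (E → Bool) → Prop) :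
    Pr q (fun x => ∃ i ∈ I, A i x) ≤ ∑ i ∈ I, Pr q (A i) := by
  unfold Pr
  rw [Finset.sum_comm]
  refine Finset.sum_le_sum fun x _ => ?_
  have hx := pw_nonneg h0 h1 x
  split_ifs with h
  · obtain ⟨i, hi, hA⟩ := h
    refine le_trans ?_ (Finset.single_le_sum (f := fun i => if A i x then pw q x else 0) ?_ hi)
    · simp [hA]
    · intro j _; split_ifs <;> simp [hx]
  · refine Finset.sum_nonneg fun j _ => ?_
    split_ifs <;> simp [hx]

lemma Pr_or {q : ℝ} (h0 : 0 ≤ q) (h1 : q ≤ 1) (A B : (E → Bool) → Prop) :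
    Pr q (fun x => A x ∨ B x) ≤ Pr q A + Pr q B := by
  unfold Pr
  rw [← Finset.sum_add_distrib]
  refine Finset.sum_le_sum fun x _ => ?_
  have hx := pw_nonneg h0 h1 x
  by_cases hA : A x <;> by_cases hB : B x <;> simp [hA, hB, hx]

lemma Pr_union_le {ι : Type*} {q : ℝ} (h0 : 0 ≤ q) (h1 : q ≤ 1) (I : Finset ι)
    (A : ι → (E → Bool) → Prop) (N c : ℝ) (hN : (I.card : ℝ) ≤ N) (hc : 0 ≤ c)
    (hA : ∀ i ∈ I, Pr q (A i) ≤ c) :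
    Pr q (fun x => ∃ i ∈ I, A i x) ≤ N * c := by
  refine (Pr_union h0 h1 I A).trans ((Finset.sum_le_sum hA).trans ?_)
  rw [Finset.sum_const, nsmul_eq_mul]
  exact mul_le_mul_of_nonneg_right hN hc

lemma Pr_none_le {ι : Type*} {q : ℝ} (h0 : 0 ≤ q) (h1 : q ≤ 1) (d : ℕ) (I : Finset ι)
    (T : ι → Finset E) (hT : (I : Set ι).PairwiseDisjoint T) (hd : ∀ i ∈ I, (T i).card ≤ d) :
    Pr q (fun x => ∀ i ∈ I, ¬ ∀ e ∈ T i, x e = true) ≤ Real.exp (-(q ^ d * I.card)) := by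
  have h := sum_pw_indep q I T hT
  have e1 : Pr q (fun x => ∀ i ∈ I, ¬ ∀ e ∈ T i, x e = true)
      = ∑ x : E → Bool, pw q x * ∏ i ∈ I, (1 - if ∀ e ∈ T i, x e = true then (1:ℝ) else 0) := by
    unfold Pr
    refine Finset.sum_congr rfl fun x _ => ?_
    have : ∀ i ∈ I, (1 - if ∀ e ∈ T i, x e = true then (1:ℝ) else 0)
        = if ¬ ∀ e ∈ T i, x e = true then (1:ℝ) else 0 := by
      intro i _
      by_cases hh : ∀ e ∈ T i, x e = true
      · rw [if_pos hh, if_neg (not_not.mpr hh)]; ring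
      · rw [if_neg hh, if_pos hh]; ring
    rw [Finset.prod_congr rfl this, Finset.prod_ite_zero]
    simp
  rw [e1, h]
  calc ∏ i ∈ I, (1 - q ^ (T i).card) ≤ ∏ i ∈ I, Real.exp (-(q ^ d)) := by
        refine Finset.prod_le_prod (fun i _ => ?_) (fun i hi => ?_)
        · have := pow_le_one₀ h0 h1 (n := (T i).card); linarith
        · have h2 : q ^ d ≤ q ^ (T i).card := pow_le_pow_of_le_one h0 h1 (hd i hi)
          have := Real.add_one_le_exp (-(q ^ d))
          linarith
    _ = Real.exp (-(q ^ d * I.card)) := by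
        rw [Finset.prod_const, ← Real.exp_nat_mul]; congr 1; ring

end prob

/-- Number of small finsets. -/
lemma card_small {V : Type} [Fintype V] (k : ℕ) :
    (Finset.univ.filter (fun Z : Finset V => Z.card ≤ k)).card ≤ (Fintype.card V + 1) ^ k := by
  have : (Finset.univ.filter (fun Z : Finset V => Z.card ≤ k)) ⊆
      (Finset.univ : Finset (Fin k → Option V)).image
        (fun f => Finset.univ.filter (fun v => ∃ i, f i = some v)) := by
    intro Z hZ
    simp only [Finset.mem_filter, Finset.mem_univ, true_and] at hZ
    simp only [Finset.mem_image, Finset.mem_univ, true_and]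
    let e := Z.equivFin
    refine ⟨fun i => if h : i.1 < Z.card then some (e.symm ⟨i.1, h⟩).1 else none, ?_⟩
    ext v
    simp only [Finset.mem_filter, Finset.mem_univ, true_and]
    constructor
    · rintro ⟨i, hi⟩
      split_ifs at hi with h
      simp only [Option.some.injEq] at hi
      rw [← hi]; exact (e.symm ⟨i.1, h⟩).2
    · intro hv
      refine ⟨⟨(e ⟨v, hv⟩).1, (e ⟨v, hv⟩).2.trans_le hZ⟩, ?_⟩
      simp
  refine (Finset.card_le_card this).trans (Finset.card_image_le.trans ?_)
  simp
/-! ### Graph events -/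

/-- `y` is adjacent to all of `S`. -/
def FullTo {V : Type} (G : SimpleGraph V) (S : Finset V) (y : V) : Prop := ∀ v ∈ S, G.Adj y v

/-- The graph of a 0/1 vector. -/
def gr {V : Type} (x : Sym2 V → Bool) : SimpleGraph V := SimpleGraph.fromEdgeSet {e | x e = true}

lemma Pr_noCompl {V : Type} [Fintype V] {ι : Type*} {q : ℝ} (h0 : 0 ≤ q) (h1 : q ≤ 1) (d : ℕ)
    (S : ι → Finset V) (I : Finset ι) (Y : Finset V) (hS : (I : Set ι).PairwiseDisjoint S)
    (hd : ∀ j ∈ I, (S j).card ≤ d) (hY : ∀ j ∈ I, Disjoint (S j) Y) :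
    Pr q (fun x => ∀ j ∈ I, ∀ y ∈ Y, ¬ FullTo (gr x) (S j) y)
      ≤ Real.exp (-(q ^ d * (I.card * Y.card))) := by
  have := Pr_none_le h0 h1 d (I ×ˢ Y) (fun jy => (S jy.1).image (fun v => s(jy.2, v))) ?_ ?_
  · rw [Finset.card_product] at this
    push_cast at this
    refine le_trans (Pr_mono h0 h1 ?_) this
    rintro x hx ⟨j, y⟩ hjy hall
    rw [Finset.mem_product] at hjy
    refine hx j hjy.1 y hjy.2 ?_
    intro v hv
    simp only [gr, SimpleGraph.fromEdgeSet_adj, Set.mem_ofPred_eq]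
    refine ⟨hall _ (Finset.mem_image_of_mem _ hv), ?_⟩
    rintro rfl
    exact Finset.disjoint_left.mp (hY j hjy.1) hv hjy.2
  · rintro ⟨j, y⟩ hj ⟨j', y'⟩ hj' hne
    simp only [Finset.coe_product, Set.mem_prod, Finset.mem_coe] at hj hj'
    simp only [Function.onFun]
    rw [Finset.disjoint_left]
    intro e he he'
    simp only [Finset.mem_image] at he he'
    obtain ⟨v, hv, rfl⟩ := he
    obtain ⟨v', hv', heq⟩ := he'
    rw [Sym2.eq_iff] at heq
    rcases heq with ⟨rfl, rfl⟩ | ⟨rfl, rfl⟩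
    · have : j ≠ j' := by rintro rfl; exact hne rfl
      exact Finset.disjoint_left.mp (hS hj.1 hj'.1 this) hv hv'
    · exact Finset.disjoint_left.mp (hY j hj.1) hv hj'.2
  · rintro ⟨j, y⟩ hj
    rw [Finset.mem_product] at hj
    exact Finset.card_image_le.trans (hd j hj.1)

/-- First expansion property. -/
def GoodA {V : Type} (G : SimpleGraph V) (d a k : ℕ) (Yof : Finset V → Finset V) :
    Prop :=
  ∀ S : Fin k → Finset V, (∀ j, (S j).card ≤ d) → (∀ i j, i ≠ j → Disjoint (S i) (S j)) →
    ∀ Z : Finset V, Z.card ≤ k → (∀ j, Disjoint (S j) (Yof Z)) → a ≤ (Yof Z).card →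
      ∃ j, ∃ y ∈ Yof Z, FullTo G (S j) y

lemma Pr_goodA {V : Type} [Fintype V] {q : ℝ} (h0 : 0 ≤ q) (h1 : q ≤ 1) (d a k : ℕ)
    (Yof : Finset V → Finset V) :
    Pr q (fun x => ¬ GoodA (gr x) d a k Yof)
      ≤ (((Fintype.card V : ℝ) + 1) ^ (d + 1) * Real.exp (-(q ^ d * a))) ^ k := by
  let I : Finset ((Fin k → Finset V) × Finset V) :=
    ((Fintype.piFinset (fun _ : Fin k => Finset.univ.filter (fun Z : Finset V => Z.card ≤ d))) ×ˢ
      (Finset.univ.filter (fun Z : Finset V => Z.card ≤ k))).filter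
      (fun SZ => (∀ i j, i ≠ j → Disjoint (SZ.1 i) (SZ.1 j)) ∧
        (∀ j, Disjoint (SZ.1 j) (Yof SZ.2)) ∧ a ≤ (Yof SZ.2).card)
  have hI : (I.card : ℝ) ≤ ((Fintype.card V : ℝ) + 1) ^ ((d + 1) * k) := by
    have h2 : I.card ≤ (Fintype.card V + 1) ^ ((d + 1) * k) := by
      refine (Finset.card_filter_le _ _).trans ?_
      rw [Finset.card_product, Fintype.card_piFinset_const]
      calc _ ≤ ((Fintype.card V + 1) ^ d) ^ k * (Fintype.card V + 1) ^ k :=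
            Nat.mul_le_mul (Nat.pow_le_pow_left (card_small d) _) (card_small k)
        _ = _ := by rw [← pow_mul, ← pow_add]; ring
    exact_mod_cast h2
  have := Pr_union_le h0 h1 I
    (fun SZ x => ∀ j ∈ Finset.univ, ∀ y ∈ Yof SZ.2, ¬ FullTo (gr x) (SZ.1 j) y)
    _ (Real.exp (-(q ^ d * a)) ^ k) hI (by positivity) ?_
  · rw [mul_pow, ← pow_mul]
    refine le_trans (Pr_mono h0 h1 ?_) this
    intro x hx
    unfold GoodA at hx
    push Not at hx
    obtain ⟨S, h1, h2, Z, h3, h4, h5, h6⟩ := hx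
    refine ⟨(S, Z), ?_, fun j _ => h6 j⟩
    simp only [I, Finset.mem_filter, Finset.mem_product, Fintype.mem_piFinset, Finset.mem_univ,
      true_and]
    exact ⟨⟨h1, h3⟩, h2, h4, h5⟩
  · rintro ⟨S, Z⟩ hSZ
    simp only [I, Finset.mem_filter, Finset.mem_product, Fintype.mem_piFinset, Finset.mem_univ,
      true_and] at hSZ
    obtain ⟨⟨h2, h3⟩, h4, h5, h6⟩ := hSZ
    refine (Pr_noCompl h0 h1 d S Finset.univ (Yof Z) (fun i _ j _ hij => h4 i j hij)
      (fun j _ => h2 j) (fun j _ => h5 j)).trans ?_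
    rw [← Real.exp_nat_mul, Real.exp_le_exp, Finset.card_univ, Fintype.card_fin]
    have h7 : (a : ℝ) ≤ ((Yof Z).card : ℝ) := by exact_mod_cast h6
    have h8 : 0 ≤ q ^ d := by positivity
    have h9 : (0:ℝ) ≤ k := by positivity
    nlinarith [mul_le_mul_of_nonneg_left h7 (mul_nonneg h8 h9)]

/-- Expansion from the other side. -/
def GoodB {V : Type} (G : SimpleGraph V) (m : ℕ) (A : Fin m → Finset V) (l : ℕ) : Prop :=
  ∀ Y : Finset V, Y.card = l → ∀ D : Finset (Fin m), D.card ≤ 2 * l →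
    (∀ j, j ∉ D → Disjoint (A j) Y) → ∃ j, j ∉ D ∧ ∃ y ∈ Y, FullTo G (A j) y

lemma Pr_goodB {V : Type} [Fintype V] {q : ℝ} (h0 : 0 ≤ q) (h1 : q ≤ 1) (d a m l : ℕ)
    (A : Fin m → Finset V) (hA : ∀ j, (A j).card ≤ d) (hd : 2 ≤ d)
    (hAd : ∀ i j, i ≠ j → Disjoint (A i) (A j)) (hm : m ≤ Fintype.card V)
    (hl : 2 * l + a ≤ m) :
    Pr q (fun x => ¬ GoodB (gr x) m A l)
      ≤ (((Fintype.card V : ℝ) + 1) ^ (d + 1) * Real.exp (-(q ^ d * a))) ^ l := by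
  let I : Finset (Finset V × Finset (Fin m)) :=
    ((Finset.univ.filter (fun Z : Finset V => Z.card ≤ l)) ×ˢ
      (Finset.univ.filter (fun Z : Finset (Fin m) => Z.card ≤ 2 * l))).filter
      (fun YD => YD.1.card = l ∧ ∀ j, j ∉ YD.2 → Disjoint (A j) YD.1)
  have hI : (I.card : ℝ) ≤ ((Fintype.card V : ℝ) + 1) ^ ((d + 1) * l) := by
    have h2 : I.card ≤ (Fintype.card V + 1) ^ ((d + 1) * l) := by
      refine (Finset.card_filter_le _ _).trans ?_
      rw [Finset.card_product]
      calc _ ≤ (Fintype.card V + 1) ^ l * (Fintype.card V + 1) ^ (2 * l) := by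
            refine Nat.mul_le_mul (card_small l) ((card_small (2 * l)).trans ?_)
            refine Nat.pow_le_pow_left ?_ _
            simpa using hm
        _ = (Fintype.card V + 1) ^ (3 * l) := by rw [← pow_add]; ring
        _ ≤ _ := Nat.pow_le_pow_right (by omega) (Nat.mul_le_mul_right _ (by omega))
    exact_mod_cast h2
  have := Pr_union_le h0 h1 I
    (fun YD x => ∀ j ∈ YD.2ᶜ, ∀ y ∈ YD.1, ¬ FullTo (gr x) (A j) y)
    _ (Real.exp (-(q ^ d * a)) ^ l) hI (by positivity) ?_
  · rw [mul_pow, ← pow_mul]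
    refine le_trans (Pr_mono h0 h1 ?_) this
    intro x hx
    unfold GoodB at hx
    push Not at hx
    obtain ⟨Y, h1, D, h2, h3, h4⟩ := hx
    refine ⟨(Y, D), ?_, fun j hj => h4 j (by simpa using hj)⟩
    simp only [I, Finset.mem_filter, Finset.mem_product, Finset.mem_univ, true_and]
    exact ⟨⟨h1.le, h2⟩, h1, h3⟩
  · rintro ⟨Y, D⟩ hSZ
    simp only [I, Finset.mem_filter, Finset.mem_product, Finset.mem_univ, true_and] at hSZ
    obtain ⟨⟨h2, h3⟩, h4, h5⟩ := hSZ
    refine (Pr_noCompl h0 h1 d A Dᶜ Y (fun i _ j _ hij => hAd i j hij)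
      (fun j _ => hA j) (fun j hj => h5 j (by simpa using hj))).trans ?_
    rw [← Real.exp_nat_mul, Real.exp_le_exp, h4]
    have h6 : a ≤ (Dᶜ).card := by
      rw [Finset.card_compl, Fintype.card_fin]; omega
    have h7 : (a : ℝ) ≤ ((Dᶜ).card : ℝ) := by exact_mod_cast h6
    have h8 : 0 ≤ q ^ d := by positivity
    have h9 : (0:ℝ) ≤ l := by positivity
    nlinarith [mul_le_mul_of_nonneg_left h7 (mul_nonneg h8 h9)]

/-! ### Linking with `gnpProb` -/

lemma gnpProb_eq (n : ℕ) (p q : ℝ) (hq : (1 - q) ^ 2 = 1 - p) (P : SimpleGraph (Fin n) → Prop) :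
    gnpProb n p P = ∑ x : Sym2 (Fin n) → Bool, ∑ y : Sym2 (Fin n) → Bool,
      if P (gr x ⊔ gr y) then pw q x * pw q y else 0 := by
  -- regroup as a sum over vectors of pairs
  have h1 : (∑ x : Sym2 (Fin n) → Bool, ∑ y : Sym2 (Fin n) → Bool,
      if P (gr x ⊔ gr y) then pw q x * pw q y else 0)
      = ∑ z : Sym2 (Fin n) → Bool × Bool,
        if P (gr (fun e => (z e).1) ⊔ gr (fun e => (z e).2)) then
          ∏ e, (bw q (z e).1 * bw q (z e).2) else 0 := by
    rw [← Finset.sum_product', Finset.univ_product_univ]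
    refine (Fintype.sum_equiv (Equiv.arrowProdEquivProdArrow (Sym2 (Fin n)) (fun _ => Bool) (fun _ => Bool)) _ _ ?_).symm
    intro z
    simp only [Finset.prod_mul_distrib, pw, Equiv.arrowProdEquivProdArrow]
    rfl
  rw [h1]
  rw [← Finset.sum_fiberwise (s := Finset.univ)
    (g := fun z : Sym2 (Fin n) → Bool × Bool => gr (fun e => (z e).1) ⊔ gr (fun e => (z e).2))]
  unfold gnpProb
  refine Finset.sum_congr rfl fun G _ => ?_
  by_cases hP : P G
  swap
  · rw [if_neg hP]
    symm
    refine Finset.sum_eq_zero fun z hz => ?_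
    simp only [Finset.mem_filter, Finset.mem_univ, true_and] at hz
    rw [hz, if_neg hP]
  rw [if_pos hP]
  have h2 : ∑ z ∈ Finset.univ.filter (fun z : Sym2 (Fin n) → Bool × Bool =>
        gr (fun e => (z e).1) ⊔ gr (fun e => (z e).2) = G),
      (if P (gr (fun e => (z e).1) ⊔ gr (fun e => (z e).2)) then
          ∏ e, (bw q (z e).1 * bw q (z e).2) else 0)
      = ∑ z ∈ Fintype.piFinset (fun e : Sym2 (Fin n) => Finset.univ.filter
          (fun b : Bool × Bool => e.IsDiag ∨ ((b.1 = true ∨ b.2 = true) ↔ e ∈ G.edgeSet))),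
        ∏ e, (bw q (z e).1 * bw q (z e).2) := by
    have h3 : ∀ z ∈ Finset.univ.filter (fun z : Sym2 (Fin n) → Bool × Bool =>
        gr (fun e => (z e).1) ⊔ gr (fun e => (z e).2) = G),
      (if P (gr (fun e => (z e).1) ⊔ gr (fun e => (z e).2)) then
          ∏ e, (bw q (z e).1 * bw q (z e).2) else 0) = ∏ e, (bw q (z e).1 * bw q (z e).2) := by
      intro z hz
      simp only [Finset.mem_filter, Finset.mem_univ, true_and] at hz
      rw [hz, if_pos hP]
    rw [Finset.sum_congr rfl h3]
    refine Finset.sum_congr ?_ fun _ _ => rfl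
    ext z
    simp only [Finset.mem_filter, Finset.mem_univ, true_and, Fintype.mem_piFinset]
    constructor
    · rintro rfl e
      by_cases he : e.IsDiag
      · exact Or.inl he
      · right
        simp [gr, SimpleGraph.edgeSet_sup, SimpleGraph.edgeSet_fromEdgeSet, he]
    · intro h
      rw [← SimpleGraph.edgeSet_inj]
      ext e
      by_cases he : e.IsDiag
      · constructor
        · intro h'; exact absurd he (SimpleGraph.not_isDiag_of_mem_edgeSet _ h')
        · intro h'; exact absurd he (SimpleGraph.not_isDiag_of_mem_edgeSet _ h')
      · have := (h e).resolve_left he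
        rw [← this]
        simp [gr, SimpleGraph.edgeSet_sup, SimpleGraph.edgeSet_fromEdgeSet, he]
  rw [h2, ← Finset.prod_univ_sum (f := fun (_ : Sym2 (Fin n)) (b : Bool × Bool) => bw q b.1 * bw q b.2)]
  have h4 : ∀ e : Sym2 (Fin n), (∑ b ∈ Finset.univ.filter
          (fun b : Bool × Bool => e.IsDiag ∨ ((b.1 = true ∨ b.2 = true) ↔ e ∈ G.edgeSet)),
          bw q b.1 * bw q b.2)
      = (if e ∈ G.edgeFinset then p else 1) *
        (if e ∈ (⊤ : SimpleGraph (Fin n)).edgeFinset \ G.edgeFinset then 1 - p else 1) := by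
    intro e
    rw [Finset.sum_filter, Fintype.sum_prod_type]
    by_cases hd : e.IsDiag
    · have : e ∉ G.edgeSet := fun h' => SimpleGraph.not_isDiag_of_mem_edgeSet _ h' hd
      simp [hd, this, bw]
      ring
    · by_cases he : e ∈ G.edgeSet
      · simp [hd, he, bw]
        nlinarith
      · simp [hd, he, bw]
        nlinarith
  simp only [h4]
  rw [Finset.prod_mul_distrib, Finset.prod_ite_mem, Finset.prod_ite_mem, Finset.univ_inter,
    Finset.univ_inter, Finset.prod_const, Finset.prod_const, Finset.card_sdiff_of_subset
      (SimpleGraph.edgeFinset_mono le_top),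
    SimpleGraph.card_edgeFinset_top_eq_card_choose_two, Fintype.card_fin]
  have h5 : edgeCount G = G.edgeFinset.card := by
    unfold edgeCount
    rw [Nat.card_eq_fintype_card, SimpleGraph.edgeFinset_card]
  rw [h5]
/-! ### Deterministic embedding -/

/-- The combined property of the first random graph. -/
def Good1 {V : Type} (G : SimpleGraph V) (d a K : ℕ) (R : ℕ → Finset V) : Prop :=
  (∀ r < K, ∀ k, 1 ≤ k → k ≤ a → GoodA G d a k (fun Z => R r \ Z)) ∧
    GoodA G d a a (fun Z => Z)

section engine
variable {V : Type} {ι : Type*}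

lemma hall_small (G : SimpleGraph V) (d a : ℕ) (R0 F : Finset V)
    (hR : ∀ k, 1 ≤ k → k ≤ a → GoodA G d a k (fun Z => R0 \ Z)) (hRc : R0.card = 2 * a)
    (hRF : R0 ⊆ F) (S : ι → Finset V) (hS : ∀ j, (S j).card ≤ d)
    (hSd : ∀ i j, i ≠ j → Disjoint (S i) (S j)) (hSF : ∀ j, Disjoint (S j) F)
    (J : Finset ι) (hJ : J.card ≤ a) :
    J.card ≤ (J.biUnion (fun w => F.filter (FullTo G (S w)))).card := by
  by_contra hlt
  push Not at hlt
  set N := J.biUnion (fun w => F.filter (FullTo G (S w))) with hN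
  obtain ⟨j, y, hy, hf⟩ := hR J.card (by omega) hJ (fun j => S (J.equivFin.symm j).1) (fun j => hS _)
    (fun i j hij => hSd _ _ (fun h => hij (J.equivFin.symm.injective (Subtype.ext h)))) N hlt.le
    (fun j => (hSF _).mono_right (Finset.sdiff_subset.trans hRF))
    (by have := Finset.le_card_sdiff N R0; show a ≤ (R0 \ N).card; omega)
  rw [Finset.mem_sdiff] at hy
  refine hy.2 ?_
  rw [hN, Finset.mem_biUnion]
  exact ⟨_, (J.equivFin.symm j).2, Finset.mem_filter.mpr ⟨hRF hy.1, hf⟩⟩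

lemma hall_big (G : SimpleGraph V) (d a : ℕ) (F : Finset V) (hE : GoodA G d a a (fun Z => Z))
    (S : ι → Finset V) (hS : ∀ j, (S j).card ≤ d)
    (hSd : ∀ i j, i ≠ j → Disjoint (S i) (S j)) (hSF : ∀ j, Disjoint (S j) F)
    (J : Finset ι) (hJ : a ≤ J.card) :
    (F \ (J.biUnion (fun w => F.filter (FullTo G (S w))))).card < a := by
  by_contra hlt
  push Not at hlt
  obtain ⟨J', hJ', hJc⟩ := Finset.exists_subset_card_eq hJ
  obtain ⟨Y, hY, hYc⟩ := Finset.exists_subset_card_eq hlt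
  let e : Fin a ≃ J' := (finCongr hJc.symm).trans J'.equivFin.symm
  obtain ⟨j, y, hy, hf⟩ := hE (fun j => S (e j).1) (fun j => hS _)
    (fun i j hij => hSd _ _ (fun h => hij (e.injective (Subtype.ext h)))) Y hYc.le
    (fun j => (hSF _).mono_right (hY.trans Finset.sdiff_subset)) hYc.ge
  have h := hY hy
  rw [Finset.mem_sdiff] at h
  refine h.2 ?_
  rw [Finset.mem_biUnion]
  exact ⟨_, hJ' (e j).2, Finset.mem_filter.mpr ⟨h.1, hf⟩⟩

lemma engine [Fintype ι] (G : SimpleGraph V) (d a : ℕ) (R0 F : Finset V)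
    (hR : ∀ k, 1 ≤ k → k ≤ a → GoodA G d a k (fun Z => R0 \ Z))
    (hE : GoodA G d a a (fun Z => Z)) (hRc : R0.card = 2 * a)
    (hRF : R0 ⊆ F) (S : ι → Finset V) (hS : ∀ j, (S j).card ≤ d)
    (hSd : ∀ i j, i ≠ j → Disjoint (S i) (S j)) (hSF : ∀ j, Disjoint (S j) F)
    (hF : Fintype.card ι + a ≤ F.card) :
    ∃ g : ι → V, Function.Injective g ∧ ∀ w, g w ∈ F ∧ FullTo G (S w) (g w) := by
  obtain ⟨g, hg, hg'⟩ := (Finset.all_card_le_biUnion_card_iff_exists_injective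
    (fun w => F.filter (FullTo G (S w)))).mp (fun J => by
      rcases le_total J.card a with hJ | hJ
      · exact hall_small G d a R0 F hR hRc hRF S hS hSd hSF J hJ
      · have h1 := hall_big G d a F hE S hS hSd hSF J hJ
        have h2 := Finset.le_card_sdiff (J.biUnion (fun w => F.filter (FullTo G (S w)))) F
        have h3 := Finset.card_le_univ J
        omega)
  exact ⟨g, hg, fun w => by simpa using hg' w⟩

lemma engine_last [Fintype ι] (G G2 : SimpleGraph V) (d a m : ℕ) (R0 F : Finset V)
    (hR : ∀ k, 1 ≤ k → k ≤ a → GoodA G d a k (fun Z => R0 \ Z))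
    (hE : GoodA G d a a (fun Z => Z)) (hRc : R0.card = 2 * a)
    (hRF : R0 ⊆ F) (S : ι → Finset V) (hS : ∀ j, (S j).card ≤ d)
    (hSd : ∀ i j, i ≠ j → Disjoint (S i) (S j)) (hSF : ∀ j, Disjoint (S j) F)
    (A : Fin m → Finset V) (hAd : ∀ i j, i ≠ j → Disjoint (A i) (A j)) (e : ι ≃ Fin m)
    (hSA : ∀ w, S w ⊆ A (e w)) (hB : ∀ l, 1 ≤ l → l ≤ a → GoodB G2 m A l)
    (hF : F.card = m) :
    ∃ g : ι → V, Function.Injective g ∧ ∀ w, g w ∈ F ∧ FullTo (G ⊔ G2) (S w) (g w) := by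
  have hmono : ∀ J : Finset ι, (J.biUnion (fun w => F.filter (FullTo G (S w)))) ⊆
      (J.biUnion (fun w => F.filter (FullTo (G ⊔ G2) (S w)))) := by
    intro J
    refine Finset.biUnion_mono fun w _ => ?_
    intro y hy
    rw [Finset.mem_filter] at hy ⊢
    exact ⟨hy.1, fun v hv => Or.inl (hy.2 v hv)⟩
  obtain ⟨g, hg, hg'⟩ := (Finset.all_card_le_biUnion_card_iff_exists_injective
    (fun w => F.filter (FullTo (G ⊔ G2) (S w)))).mp (fun J => by
      rcases le_total J.card a with hJ | hJ
      · exact (hall_small G d a R0 F hR hRc hRF S hS hSd hSF J hJ).trans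
          (Finset.card_le_card (hmono J))
      · by_contra hlt
        push Not at hlt
        have h1 := hall_big G d a F hE S hS hSd hSF J hJ
        have h1' := Finset.card_le_card (Finset.sdiff_subset_sdiff (Finset.Subset.refl F) (hmono J))
        set N := (J.biUnion (fun w => F.filter (FullTo (G ⊔ G2) (S w)))) with hN
        set Y := F \ N with hY
        have h2 : F.card - N.card ≤ Y.card := Finset.le_card_sdiff N F
        have h3 := Finset.card_le_univ J
        have hcm : Fintype.card ι = m := by simpa using Fintype.card_congr e
        -- the excluded indices
        let D1 : Finset (Fin m) := (J.image e)ᶜ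
        let D2 : Finset (Fin m) := Finset.univ.filter (fun j => ¬ Disjoint (A j) Y)
        have hD1 : D1.card ≤ Y.card := by
          have : (J.image e).card = J.card := Finset.card_image_of_injective _ e.injective
          simp only [D1]
          rw [Finset.card_compl, Fintype.card_fin, this]
          omega
        have hD2 : D2.card ≤ Y.card := by
          have hex : ∀ j ∈ D2, ∃ y, y ∈ A j ∧ y ∈ Y := by
            intro j hj
            simp only [D2, Finset.mem_filter, Finset.mem_univ, true_and] at hj
            exact Finset.not_disjoint_iff.mp hj
          have hYpos : 0 < Y.card := by omega
          obtain ⟨y0, _⟩ := Finset.card_pos.mp hYpos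
          haveI : Nonempty V := ⟨y0⟩
          choose! c hc using hex
          refine Finset.card_le_card_of_injOn c (fun j hj => (hc j hj).2) ?_
          intro j hj j' hj' hcc
          by_contra hne
          have h5 := (hc j hj).1
          rw [hcc] at h5
          exact Finset.disjoint_left.mp (hAd j j' hne) h5 (hc j' hj').1
        obtain ⟨j, hj, y, hy, hf⟩ := hB Y.card (by omega) (by omega) Y rfl (D1 ∪ D2)
          ((Finset.card_union_le _ _).trans (by omega)) (by
            intro j hj
            rw [Finset.mem_union, not_or] at hj
            have := hj.2
            simpa [D2] using this)
        rw [Finset.mem_union, not_or] at hj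
        have hj1 := hj.1
        simp only [D1, Finset.mem_compl, not_not, Finset.mem_image] at hj1
        obtain ⟨w, hw, rfl⟩ := hj1
        rw [hY, Finset.mem_sdiff] at hy
        refine hy.2 ?_
        rw [hN, Finset.mem_biUnion]
        exact ⟨w, hw, Finset.mem_filter.mpr ⟨hy.1, fun v hv => Or.inr (hf v (hSA w hv))⟩⟩)
  exact ⟨g, hg, fun w => by simpa using hg' w⟩

end engine

/-- Building the disjoint cliques. -/
lemma cliques {n : ℕ} (G : SimpleGraph (Fin n)) (d a K m : ℕ) (R : ℕ → Finset (Fin n))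
    (hG : Good1 G d a K R) (hRc : ∀ r < K, (R r).card = 2 * a)
    (hRd : ∀ r < K, ∀ r' < K, r ≠ r' → Disjoint (R r) (R r'))
    (hdK : d ≤ K) (hKa : 4 * a * K ≤ m) (hn : 2 * d * m ≤ n) (hd : 2 ≤ d) :
    ∀ r ≤ d, ∃ A : Fin m → Finset (Fin n), (∀ j, (A j).card = r) ∧
      (∀ i j, i ≠ j → Disjoint (A i) (A j)) ∧
      (∀ j, ∀ u ∈ A j, ∀ v ∈ A j, u ≠ v → G.Adj u v) ∧
      (∀ j, ∀ r', r ≤ r' → r' < K → Disjoint (A j) (R r')) := by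
  intro r
  induction r with
  | zero => intro _; exact ⟨fun _ => ∅, by simp, by simp, by simp, by simp⟩
  | succ r ih =>
    intro hr
    obtain ⟨A, hA1, hA2, hA3, hA4⟩ := ih (by omega)
    let B : Finset (Fin n) := Finset.univ.biUnion A ∪ (Finset.Ico (r+1) K).biUnion R
    have hB : B.card ≤ m * r + K * (2 * a) := by
      refine (Finset.card_union_le _ _).trans (Nat.add_le_add ?_ ?_)
      · refine (Finset.card_biUnion_le_card_mul _ _ r fun j _ => (hA1 j).le).trans ?_
        simp
      · refine (Finset.card_biUnion_le_card_mul _ _ (2 * a) fun j hj => ?_).trans ?_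
        · rw [Finset.mem_Ico] at hj; exact (hRc j hj.2).le
        · rw [Nat.card_Ico]; exact Nat.mul_le_mul_right _ (by omega)
    have ha : a ≤ m := by nlinarith
    obtain ⟨g, hg, hg'⟩ := engine (ι := Fin m) G d a (R r) Bᶜ (hG.1 r (by omega)) hG.2
      (hRc r (by omega)) (by
        intro v hv
        rw [Finset.mem_compl]
        intro hvB
        rw [Finset.mem_union, Finset.mem_biUnion, Finset.mem_biUnion] at hvB
        rcases hvB with ⟨j, _, hj⟩ | ⟨r', hr', hj⟩
        · exact Finset.disjoint_left.mp (hA4 j r le_rfl (by omega)) hj hv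
        · rw [Finset.mem_Ico] at hr'
          exact Finset.disjoint_left.mp (hRd r (by omega) r' hr'.2 (by omega)) hv hj)
      A (fun j => by rw [hA1]; omega) hA2 (by
        intro j
        rw [Finset.disjoint_left]
        intro v hv
        rw [Finset.mem_compl, not_not, Finset.mem_union, Finset.mem_biUnion]
        exact Or.inl ⟨j, Finset.mem_univ _, hv⟩) (by
        rw [Finset.card_compl, Fintype.card_fin, Fintype.card_fin]
        have : m * r + m ≤ d * m := by nlinarith
        have h2 : 2 * m ≤ d * m := Nat.mul_le_mul_right _ hd
        have : 2 * d * m = d * m + d * m := by ring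
        have h3 : K * (2 * a) * 2 = 4 * a * K := by ring
        omega)
    have hgA : ∀ i j, g i ∉ A j := by
      intro i j h
      have := (hg' i).1
      rw [Finset.mem_compl] at this
      exact this (Finset.mem_union_left _ (Finset.mem_biUnion.mpr ⟨j, Finset.mem_univ _, h⟩))
    refine ⟨fun j => insert (g j) (A j), ?_, ?_, ?_, ?_⟩
    · intro j
      rw [Finset.card_insert_of_notMem (hgA j j), hA1]
    · intro i j hij
      rw [Finset.disjoint_insert_left, Finset.disjoint_insert_right, Finset.mem_insert, not_or]
      exact ⟨⟨fun h => hij (hg h), hgA i j⟩, hgA j i, hA2 i j hij⟩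
    · intro j u hu v hv huv
      rw [Finset.mem_insert] at hu hv
      rcases hu with rfl | hu <;> rcases hv with rfl | hv
      · exact absurd rfl huv
      · exact (hg' j).2 v hv
      · exact ((hg' j).2 u hu).symm
      · exact hA3 j u hu v hv huv
    · intro j r' hr' hr'K
      rw [Finset.disjoint_insert_left]
      refine ⟨fun h => ?_, hA4 j r' (by omega) hr'K⟩
      have := (hg' j).1
      rw [Finset.mem_compl] at this
      exact this (Finset.mem_union_right _ (Finset.mem_biUnion.mpr
        ⟨r', Finset.mem_Ico.mpr ⟨hr', hr'K⟩, h⟩))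
lemma extend_emb {V : Type} (G H : SimpleGraph V) (U W : Set V) (f : V → V) (g : W → V)
    (hUW : ∀ v ∈ U, v ∉ W) (hf : Set.InjOn f U)
    (hfe : ∀ u ∈ U, ∀ v ∈ U, H.Adj u v → G.Adj (f u) (f v)) (hg : Function.Injective g)
    (hgf : ∀ w, ∀ v ∈ U, g w ≠ f v)
    (hge : ∀ w : W, ∀ v ∈ U, H.Adj w v → G.Adj (g w) (f v))
    (hW : ∀ u ∈ W, ∀ v ∈ W, ¬ H.Adj u v) :
    ∃ f' : V → V, Set.InjOn f' (U ∪ W) ∧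
      (∀ u ∈ U ∪ W, ∀ v ∈ U ∪ W, H.Adj u v → G.Adj (f' u) (f' v)) ∧
      (∀ v ∈ U, f' v = f v) ∧ (∀ w : W, f' w = g w) := by
  let f' : V → V := fun v => if h : v ∈ W then g ⟨v, h⟩ else f v
  have h1 : ∀ v ∈ U, f' v = f v := fun v hv => dif_neg (hUW v hv)
  have h2 : ∀ v (h : v ∈ W), f' v = g ⟨v, h⟩ := fun v h => dif_pos h
  refine ⟨f', ?_, ?_, h1, fun w => h2 w.1 w.2⟩
  · rintro u (hu | hu) v (hv | hv) heq
    · rw [h1 u hu, h1 v hv] at heq; exact hf hu hv heq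
    · rw [h1 u hu, h2 v hv] at heq; exact absurd heq.symm (hgf _ _ hu)
    · rw [h1 v hv, h2 u hu] at heq; exact absurd heq (hgf _ _ hv)
    · rw [h2 u hu, h2 v hv] at heq
      exact congrArg Subtype.val (hg heq)
  · rintro u (hu | hu) v (hv | hv) hadj
    · rw [h1 u hu, h1 v hv]; exact hfe u hu v hv hadj
    · rw [h1 u hu, h2 v hv]; exact (hge ⟨v, hv⟩ u hu hadj.symm).symm
    · rw [h1 v hv, h2 u hu]; exact hge ⟨u, hu⟩ v hv hadj
    · exact absurd hadj (hW u hu v hv)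

lemma exists_inj_map {V : Type} (N A : Finset V) (h : N.card ≤ A.card) :
    ∃ φ : V → V, (∀ v ∈ N, φ v ∈ A) ∧ Set.InjOn φ N := by
  obtain ⟨e⟩ := Function.Embedding.nonempty_of_card_le (α := N) (β := A) (by simpa using h)
  refine ⟨fun v => if h : v ∈ N then (e ⟨v, h⟩).1 else v, ?_, ?_⟩
  · intro v hv; simp only [hv, dif_pos]; exact (e ⟨v, hv⟩).2
  · intro u hu v hv heq
    rw [Finset.mem_coe] at hu hv
    simp only [hu, hv, dif_pos] at heq
    exact congrArg Subtype.val (e.injective (Subtype.ext heq))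

lemma indep1 {V : Type} {H : SimpleGraph V} {k : ℕ} (hk : 1 ≤ k) {S : Set V} (h : kIndepSet H k S)
    {u v : V} (hu : u ∈ S) (hv : v ∈ S) : ¬ H.Adj u v := by
  intro hadj
  have := h u hu v hv hadj.ne (SimpleGraph.Walk.cons hadj SimpleGraph.Walk.nil)
  simp at this
  omega

lemma indep2 {V : Type} {H : SimpleGraph V} {k : ℕ} (hk : 2 ≤ k) {S : Set V} (h : kIndepSet H k S)
    {u v x : V} (hu : u ∈ S) (hv : v ∈ S) (h1 : H.Adj u x) (h2 : H.Adj v x) : u = v := by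
  by_contra hne
  have := h u hu v hv hne (SimpleGraph.Walk.cons h1 (SimpleGraph.Walk.cons h2.symm SimpleGraph.Walk.nil))
  simp at this
  omega

lemma indep3 {V : Type} {H : SimpleGraph V} {S : Set V} (h : kIndepSet H 3 S)
    {u v x y : V} (hu : u ∈ S) (hv : v ∈ S) (h1 : H.Adj u x) (h2 : H.Adj v y) (h3 : H.Adj x y) :
    u = v := by
  by_contra hne
  have := h u hu v hv hne (SimpleGraph.Walk.cons h1 (SimpleGraph.Walk.cons h3
    (SimpleGraph.Walk.cons h2.symm SimpleGraph.Walk.nil)))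
  simp at this

/-- The deterministic embedding. -/
lemma embed {n t d a m K : ℕ} (ht : 1 ≤ t) (hd : 2 ≤ d) (hK : K = d + t + 1)
    (G G2 H : SimpleGraph (Fin n)) (R : ℕ → Finset (Fin n))
    (hG : Good1 G d a K R) (hRc : ∀ r < K, (R r).card = 2 * a)
    (hRd : ∀ r < K, ∀ r' < K, r ≠ r' → Disjoint (R r) (R r')) (hKa : 4 * a * K ≤ m)
    (A : Fin m → Finset (Fin n)) (hA1 : ∀ j, (A j).card = d)
    (hA2 : ∀ i j, i ≠ j → Disjoint (A i) (A j))
    (hA3 : ∀ j, ∀ u ∈ A j, ∀ v ∈ A j, u ≠ v → G.Adj u v)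
    (hA4 : ∀ j, ∀ r', d ≤ r' → r' < K → Disjoint (A j) (R r'))
    (hB : ∀ l, 1 ≤ l → l ≤ a → GoodB G2 m A l)
    (W : ℕ → Set (Fin n))
    (hWd : ∀ i ≤ t, ∀ j ≤ t, i ≠ j → Disjoint (W i) (W j))
    (hWu : (⋃ i ∈ Finset.range (t + 1), W i) = Set.univ)
    (hWt : Nat.card (W t) = m)
    (hW0 : W 0 = {v | v ∉ W t ∧ ∃ u ∈ W t, H.Adj u v})
    (hW3 : kIndepSet H 3 (W t))
    (hW2 : ∀ i, 1 ≤ i → i ≤ t - 1 → kIndepSet H 2 (W i))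
    (hWdeg : ∀ i, 1 ≤ i → i ≤ t → ∀ w ∈ W i,
      Nat.card {v | H.Adj w v ∧ ∃ j < i, v ∈ W j} ≤ d) :
    containsCopy (G ⊔ G2) H := by
  let U : ℕ → Set (Fin n) := fun i => {v | ∃ j ≤ i, v ∈ W j}
  have hUW : ∀ i i', i < i' → i' ≤ t → ∀ v ∈ U i, v ∉ W i' := by
    rintro i i' hii hi' v ⟨j, hj, hv⟩ hv'
    exact Set.disjoint_left.mp (hWd j (by omega) i' hi' (by omega)) hv hv'
  have hUs : ∀ i, U (i + 1) = U i ∪ W (i + 1) := by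
    intro i
    ext v
    constructor
    · rintro ⟨j, hj, hv⟩
      rcases Nat.lt_or_ge i j with h | h
      · have : j = i + 1 := by omega
        subst this; exact Or.inr hv
      · exact Or.inl ⟨j, h, hv⟩
    · rintro (⟨j, hj, hv⟩ | hv)
      · exact ⟨j, by omega, hv⟩
      · exact ⟨i + 1, le_rfl, hv⟩
  -- back-neighbourhoods
  let B : ℕ → Fin n → Finset (Fin n) := fun i w =>
    Finset.univ.filter (fun v => H.Adj w v ∧ v ∈ U i)
  have hBd : ∀ i, i + 1 ≤ t → ∀ w ∈ W (i + 1), (B i w).card ≤ d := by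
    intro i hi w hw
    have h := hWdeg (i + 1) (by omega) hi w hw
    refine le_trans (le_of_eq ?_) h
    rw [Nat.card_eq_fintype_card, ← Set.toFinset_card]
    congr 1
    ext v
    simp only [B, U, Finset.mem_filter, Finset.mem_univ, true_and, Set.mem_toFinset,
      Set.mem_ofPred_eq, Nat.lt_succ_iff]
  let e : W t ≃ Fin m := Finite.equivFinOfCardEq hWt
  have hN0 : ∀ w : W t, ∀ v, H.Adj w v → v ∈ W 0 := by
    intro w v hv
    rw [hW0]
    exact ⟨fun h => indep1 (by omega) hW3 w.2 h hv, w.1, w.2, hv⟩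
  have hSdis : ∀ i (f : Fin n → Fin n), Set.InjOn f (U i) → ∀ i', i' ≤ t → kIndepSet H 2 (W i') →
      ∀ w w' : W i', w ≠ w' → Disjoint ((B i w).image f) ((B i w').image f) := by
    intro i f hf i' _ hI w w' hne
    rw [Finset.disjoint_left]
    intro y hy hy'
    rw [Finset.mem_image] at hy hy'
    obtain ⟨u, hu, rfl⟩ := hy
    obtain ⟨u', hu', heq⟩ := hy'
    simp only [B, Finset.mem_filter, Finset.mem_univ, true_and] at hu hu'
    have := hf hu'.2 hu.2 heq
    subst this
    exact hne (Subtype.ext (indep2 le_rfl hI w.2 w'.2 hu.1 hu'.1))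
  have inv : ∀ i, i + 1 ≤ t → ∃ f : Fin n → Fin n, Set.InjOn f (U i) ∧
      (∀ u ∈ U i, ∀ v ∈ U i, H.Adj u v → G.Adj (f u) (f v)) ∧
      (∀ v ∈ U i, ∀ r', d + i < r' → r' < K → f v ∉ R r') ∧
      (∀ w : W t, ∀ v, H.Adj w v → f v ∈ A (e w)) := by
    intro i
    induction i with
    | zero =>
      intro _
      have hdeg : ∀ w : W t, (Finset.univ.filter (fun v => H.Adj w v)).card ≤ d := by
        intro w
        obtain ⟨t', rfl⟩ : ∃ t', t = t' + 1 := ⟨t - 1, by omega⟩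
        refine le_trans (Finset.card_le_card ?_) (hBd t' le_rfl w.1 w.2)
        intro v hv
        simp only [Finset.mem_filter, Finset.mem_univ, true_and] at hv
        simp only [B, Finset.mem_filter, Finset.mem_univ, true_and]
        exact ⟨hv, 0, by omega, hN0 w v hv⟩
      have hφ := fun w : W t => exists_inj_map (Finset.univ.filter (fun v => H.Adj w v)) (A (e w))
        (by rw [hA1]; exact hdeg w)
      choose φ hφ1 hφ2 using hφ
      have hf : ∀ v, ∃ y, ∀ w : W t, H.Adj w v → y = φ w v := by
        intro v
        by_cases h : ∃ w : W t, H.Adj w v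
        · obtain ⟨w, hw⟩ := h
          refine ⟨φ w v, fun w' hw' => ?_⟩
          have : w = w' := Subtype.ext (indep2 (by omega) hW3 w.2 w'.2 hw hw')
          rw [this]
        · exact ⟨v, fun w hw => absurd ⟨w, hw⟩ h⟩
      choose f hf using hf
      have hfA : ∀ w : W t, ∀ v, H.Adj w v → f v ∈ A (e w) := by
        intro w v hv
        rw [hf v w hv]
        exact hφ1 w v (by simpa using hv)
      have hpar : ∀ v ∈ U 0, ∃ w : W t, H.Adj w v := by
        rintro v ⟨j, hj, hv⟩
        obtain rfl : j = 0 := by omega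
        rw [hW0] at hv
        obtain ⟨_, u, hu, huv⟩ := hv
        exact ⟨⟨u, hu⟩, huv⟩
      have hinj : Set.InjOn f (U 0) := by
        intro u hu v hv heq
        obtain ⟨w, hw⟩ := hpar u hu
        obtain ⟨w', hw'⟩ := hpar v hv
        have hww : w = w' := by
          by_contra hne
          have h1 := hfA w u hw
          rw [heq] at h1
          exact Finset.disjoint_left.mp (hA2 _ _ (fun h => hne (e.injective h))) h1 (hfA w' v hw')
        subst hww
        rw [hf u w hw, hf v w hw'] at heq
        exact hφ2 w (by simpa using hw) (by simpa using hw') heq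
      refine ⟨f, hinj, ?_, ?_, hfA⟩
      · intro u hu v hv hadj
        obtain ⟨w, hw⟩ := hpar u hu
        obtain ⟨w', hw'⟩ := hpar v hv
        have hww : w = w' := Subtype.ext (indep3 hW3 w.2 w'.2 hw hw' hadj)
        subst hww
        exact hA3 _ _ (hfA w u hw) _ (hfA w v hw') (fun h => hadj.ne (hinj hu hv h))
      · intro v hv r' hr' hr'K
        obtain ⟨w, hw⟩ := hpar v hv
        exact Finset.disjoint_left.mp (hA4 _ r' (by omega) hr'K) (hfA w v hw)
    | succ i ih =>
      intro hi
      obtain ⟨f, hf1, hf2, hf3, hf4⟩ := ih (by omega)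
      have hI := hW2 (i + 1) (by omega) (by omega)
      let X : Finset (Fin n) := (U i).toFinset.image f ∪ (Finset.Ico (d + i + 2) K).biUnion R
      have hX : X.card ≤ (U i).toFinset.card + K * (2 * a) := by
        refine (Finset.card_union_le _ _).trans (Nat.add_le_add Finset.card_image_le ?_)
        refine (Finset.card_biUnion_le_card_mul _ _ (2 * a) fun j hj => ?_).trans ?_
        · rw [Finset.mem_Ico] at hj; exact (hRc j hj.2).le
        · rw [Nat.card_Ico]; exact Nat.mul_le_mul_right _ (by omega)
      have hcard : (U i).toFinset.card + (W (i+1)).toFinset.card + m ≤ n := by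
        have h1 : Disjoint (U i).toFinset (W (i+1)).toFinset := by
          rw [Set.disjoint_toFinset, Set.disjoint_left]
          exact hUW i (i+1) (by omega) (by omega)
        have h2 : Disjoint ((U i).toFinset ∪ (W (i+1)).toFinset) (W t).toFinset := by
          rw [← Set.toFinset_union, Set.disjoint_toFinset, ← hUs, Set.disjoint_left]
          exact hUW (i+1) t (by omega) le_rfl
        have h3 := Finset.card_le_univ (((U i).toFinset ∪ (W (i+1)).toFinset) ∪ (W t).toFinset)
        rw [Finset.card_union_of_disjoint h2, Finset.card_union_of_disjoint h1, Fintype.card_fin,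
          Set.toFinset_card (W t), ← Nat.card_eq_fintype_card, hWt] at h3
        exact h3
      obtain ⟨g, hg, hg'⟩ := engine (ι := W (i+1)) G d a (R (d + i + 1)) Xᶜ
        (hG.1 _ (by omega)) hG.2 (hRc _ (by omega)) (by
          intro v hv
          rw [Finset.mem_compl]
          intro hvX
          rw [Finset.mem_union, Finset.mem_image, Finset.mem_biUnion] at hvX
          rcases hvX with ⟨u, hu, rfl⟩ | ⟨r', hr', hj⟩
          · exact hf3 u (by simpa using hu) _ (by omega) (by omega) hv
          · rw [Finset.mem_Ico] at hr'
            exact Finset.disjoint_left.mp (hRd _ (by omega) r' hr'.2 (by omega)) hv hj)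
        (fun w => (B i w).image f)
        (fun w => Finset.card_image_le.trans (hBd i (by omega) w.1 w.2))
        (hSdis i f hf1 (i+1) (by omega) hI)
        (by
          intro w
          rw [Finset.disjoint_left]
          intro v hv
          rw [Finset.mem_image] at hv
          obtain ⟨u, hu, rfl⟩ := hv
          simp only [B, Finset.mem_filter, Finset.mem_univ, true_and] at hu
          rw [Finset.mem_compl, not_not]
          exact Finset.mem_union_left _ (Finset.mem_image_of_mem _ (by simpa using hu.2)))
        (by
          rw [Finset.card_compl, Fintype.card_fin, ← Set.toFinset_card]
          have h3 : K * (2 * a) * 2 = 4 * a * K := by ring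
          have h4 : a * 1 ≤ a * K := Nat.mul_le_mul_left _ (by omega)
          have h5 : 4 * a * K = 4 * (a * K) := by ring
          omega)
      have hgX : ∀ w, g w ∉ X := fun w => by have := (hg' w).1; rwa [Finset.mem_compl] at this
      obtain ⟨f', h1, h2, h3, h4⟩ := extend_emb G H (U i) (W (i+1)) f g
        (hUW i (i+1) (by omega) (by omega)) hf1 hf2 hg
        (fun w v hv h => hgX w (Finset.mem_union_left _ (Finset.mem_image.mpr
          ⟨v, by simpa using hv, h.symm⟩)))
        (fun w v hv hadj => (hg' w).2 _ (Finset.mem_image_of_mem _ (by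
          simp only [B, Finset.mem_filter, Finset.mem_univ, true_and]
          exact ⟨hadj, hv⟩)))
        (fun u hu v hv => indep1 (by omega) hI hu hv)
      rw [← hUs] at h1 h2
      refine ⟨f', h1, h2, ?_, ?_⟩
      · intro v hv r' hr' hr'K
        rw [hUs] at hv
        rcases hv with hv | hv
        · rw [h3 v hv]; exact hf3 v hv r' (by omega) hr'K
        · rw [h4 ⟨v, hv⟩]
          intro hmem
          exact hgX ⟨v, hv⟩ (Finset.mem_union_right _ (Finset.mem_biUnion.mpr
            ⟨r', Finset.mem_Ico.mpr ⟨by omega, hr'K⟩, hmem⟩))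
      · intro w v hadj
        rw [h3 v ⟨0, by omega, hN0 w v hadj⟩]
        exact hf4 w v hadj
  -- the last step
  obtain ⟨t', rfl⟩ : ∃ t', t = t' + 1 := ⟨t - 1, by omega⟩
  obtain ⟨f, hf1, hf2, hf3, hf4⟩ := inv t' le_rfl
  have hUu : U t' ∪ W (t' + 1) = Set.univ := by
    rw [← hUs, Set.eq_univ_iff_forall]
    intro v
    have hv : v ∈ (⋃ i ∈ Finset.range (t' + 1 + 1), W i) := by rw [hWu]; trivial
    simp only [Set.mem_iUnion, Finset.mem_range] at hv
    obtain ⟨j, hj, hv⟩ := hv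
    exact ⟨j, by omega, hv⟩
  have hcard : (U t').toFinset.card + m = n := by
    have h1 : Disjoint (U t').toFinset (W (t'+1)).toFinset := by
      rw [Set.disjoint_toFinset, Set.disjoint_left]
      exact hUW t' (t'+1) (by omega) (by omega)
    have h2 := Finset.card_union_of_disjoint h1
    rw [Set.toFinset_card (W (t'+1)), ← Nat.card_eq_fintype_card, hWt, ← Set.toFinset_union] at h2
    rw [← h2]
    have : (U t' ∪ W (t' + 1)).toFinset = Finset.univ := by
      rw [Set.toFinset_eq_univ]; exact hUu
    rw [this, Finset.card_univ, Fintype.card_fin]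
  let X : Finset (Fin n) := (U t').toFinset.image f
  have hX : X.card = (U t').toFinset.card :=
    Finset.card_image_of_injOn (by simpa using hf1)
  obtain ⟨g, hg, hg'⟩ := engine_last (ι := W (t'+1)) G G2 d a m (R (d + (t' + 1))) Xᶜ
    (hG.1 _ (by omega)) hG.2 (hRc _ (by omega)) (by
      intro v hv
      rw [Finset.mem_compl]
      intro hvX
      rw [Finset.mem_image] at hvX
      obtain ⟨u, hu, rfl⟩ := hvX
      exact hf3 u (by simpa using hu) _ (by omega) (by omega) hv)
    (fun w => (B t' w).image f)
    (fun w => Finset.card_image_le.trans (hBd t' (by omega) w.1 w.2))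
    (hSdis t' f hf1 (t'+1) (by omega) (fun u hu v hv huv w => by
      have := hW3 u hu v hv huv w; omega))
    (by
      intro w
      rw [Finset.disjoint_left]
      intro v hv
      rw [Finset.mem_image] at hv
      obtain ⟨u, hu, rfl⟩ := hv
      simp only [B, Finset.mem_filter, Finset.mem_univ, true_and] at hu
      rw [Finset.mem_compl, not_not]
      exact Finset.mem_image_of_mem _ (by simpa using hu.2))
    A hA2 e (by
      intro w v hv
      rw [Finset.mem_image] at hv
      obtain ⟨u, hu, rfl⟩ := hv
      simp only [B, Finset.mem_filter, Finset.mem_univ, true_and] at hu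
      exact hf4 w u hu.1) hB (by
      rw [Finset.card_compl, Fintype.card_fin]; omega)
  have hgX : ∀ w, g w ∉ X := fun w => by have := (hg' w).1; rwa [Finset.mem_compl] at this
  obtain ⟨f', h1, h2, -, -⟩ := extend_emb (G ⊔ G2) H (U t') (W (t'+1)) f g
    (hUW t' (t'+1) (by omega) (by omega)) hf1 (fun u hu v hv h => Or.inl (hf2 u hu v hv h)) hg
    (fun w v hv h => hgX w (Finset.mem_image.mpr ⟨v, by simpa using hv, h.symm⟩))
    (fun w v hv hadj => (hg' w).2 _ (Finset.mem_image_of_mem _ (by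
      simp only [B, Finset.mem_filter, Finset.mem_univ, true_and]
      exact ⟨hadj, hv⟩)))
    (fun u hu v hv => indep1 (by omega) hW3 hu hv)
  rw [hUu] at h1 h2
  exact ⟨f', Set.injOn_univ.mp h1, fun u v h => h2 u trivial v trivial h⟩
/-! ### Combining -/

lemma sum_pw_sym (n : ℕ) (q : ℝ) : ∑ x : Sym2 (Fin n) → Bool, pw q x = 1 := by
  convert sum_pw (E := Sym2 (Fin n)) q

open Classical in
lemma Pr_sym (n : ℕ) (q : ℝ) (A : (Sym2 (Fin n) → Bool) → Prop) :
    Pr q A = ∑ x : Sym2 (Fin n) → Bool, if A x then pw q x else 0 := by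
  unfold Pr
  congr!

lemma gnpProb_le_one (n : ℕ) (p q : ℝ) (h0 : 0 ≤ q) (h1 : q ≤ 1) (hq : (1 - q) ^ 2 = 1 - p)
    (P : SimpleGraph (Fin n) → Prop) : gnpProb n p P ≤ 1 := by
  rw [gnpProb_eq n p q hq]
  calc _ ≤ ∑ x : Sym2 (Fin n) → Bool, ∑ y : Sym2 (Fin n) → Bool, pw q x * pw q y := by
        refine Finset.sum_le_sum fun x _ => Finset.sum_le_sum fun y _ => ?_
        have := mul_nonneg (pw_nonneg h0 h1 x) (pw_nonneg h0 h1 y)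
        split_ifs <;> linarith
    _ = 1 := by simp only [← Finset.mul_sum, sum_pw_sym, mul_one]

lemma two_round (n : ℕ) (p q : ℝ) (h0 : 0 ≤ q) (h1 : q ≤ 1) (hq : (1 - q) ^ 2 = 1 - p)
    (P : SimpleGraph (Fin n) → Prop) (Q1 : (Sym2 (Fin n) → Bool) → Prop)
    (Q2 : (Sym2 (Fin n) → Bool) → (Sym2 (Fin n) → Bool) → Prop)
    (hP : ∀ x y, Q1 x → Q2 x y → P (gr x ⊔ gr y)) (c1 c2 : ℝ)
    (hQ1 : Pr q (fun x => ¬ Q1 x) ≤ c1) (hQ2 : ∀ x, Q1 x → Pr q (fun y => ¬ Q2 x y) ≤ c2)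
    (hc2 : 0 ≤ c2) :
    1 - (c1 + c2) ≤ gnpProb n p P := by
  rw [gnpProb_eq n p q hq]
  have hx : ∀ x : Sym2 (Fin n) → Bool, (if Q1 x then pw q x else 0) - c2 * pw q x ≤
      ∑ y : Sym2 (Fin n) → Bool, if P (gr x ⊔ gr y) then pw q x * pw q y else 0 := by
    intro x
    have hx0 := pw_nonneg h0 h1 x
    by_cases hQ : Q1 x
    · rw [if_pos hQ]
      have e1 := hQ2 x hQ
      have e2 := Pr_compl q (Q2 x)
      have e3 : pw q x * Pr q (Q2 x) ≤
          ∑ y : Sym2 (Fin n) → Bool, if P (gr x ⊔ gr y) then pw q x * pw q y else 0 := by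
        rw [Pr_sym, Finset.mul_sum]
        refine Finset.sum_le_sum fun y _ => ?_
        have hy0 := mul_nonneg hx0 (pw_nonneg h0 h1 y)
        by_cases h : Q2 x y
        · rw [if_pos h, if_pos (hP x y hQ h)]
        · rw [if_neg h, mul_zero]; split_ifs <;> linarith
      nlinarith
    · rw [if_neg hQ]
      have : 0 ≤ ∑ y : Sym2 (Fin n) → Bool, if P (gr x ⊔ gr y) then pw q x * pw q y else 0 := by
        refine Finset.sum_nonneg fun y _ => ?_
        have := mul_nonneg hx0 (pw_nonneg h0 h1 y)
        split_ifs <;> linarith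
      nlinarith
  refine le_trans ?_ (Finset.sum_le_sum fun x _ => hx x)
  rw [Finset.sum_sub_distrib, ← Finset.mul_sum, sum_pw_sym]
  have e2 := Pr_compl q Q1
  rw [Pr_sym n q Q1] at e2
  linarith

lemma exists_R (n a K : ℕ) (h : 2 * a * K ≤ n) : ∃ R : ℕ → Finset (Fin n),
    (∀ r < K, (R r).card = 2 * a) ∧ (∀ r < K, ∀ r' < K, r ≠ r' → Disjoint (R r) (R r')) := by
  have hlt : ∀ r < K, ∀ v ∈ Finset.Ico (2 * a * r) (2 * a * (r + 1)), v < n := by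
    intro r hr v hv
    rw [Finset.mem_Ico] at hv
    have : 2 * a * (r + 1) ≤ 2 * a * K := Nat.mul_le_mul_left _ hr
    omega
  refine ⟨fun r => if hr : r < K then (Finset.Ico (2 * a * r) (2 * a * (r + 1))).attachFin
    (hlt r hr) else ∅, ?_, ?_⟩
  · intro r hr
    simp only [hr, dif_pos]
    rw [Finset.card_attachFin, Nat.card_Ico, ← Nat.mul_sub]
    simp
  · intro r hr r' hr' hne
    simp only [hr, hr', dif_pos]
    rw [Finset.disjoint_left]
    intro v hv hv'
    rw [Finset.mem_attachFin, Finset.mem_Ico] at hv hv'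
    rcases Nat.lt_or_gt_of_ne hne with h | h
    · have : 2 * a * (r + 1) ≤ 2 * a * r' := Nat.mul_le_mul_left _ h
      omega
    · have : 2 * a * (r' + 1) ≤ 2 * a * r := Nat.mul_le_mul_left _ h
      omega

lemma main_n (n t d a m K : ℕ) (ε p q β : ℝ) (ht : 1 ≤ t) (hd : 2 ≤ d) (hK : K = d + t + 1)
    (hm : m = ⌊ε * n⌋₊) (hKa : 4 * a * K ≤ m) (hn : 2 * d * m ≤ n)
    (h0 : 0 ≤ q) (h1 : q ≤ 1) (hq : (1 - q) ^ 2 = 1 - p)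
    (hβ : β = ((n : ℝ) + 1) ^ (d + 1) * Real.exp (-(q ^ d * a)))
    (hβ' : β ≤ 1 / ((n : ℝ) + 1) ^ 3) (ha : 1 ≤ a) :
    1 - 2 / ((n : ℝ) + 1) ≤ gnpProb n p (fun G =>
          ∀ H : SimpleGraph (Fin n), inFamilyF n t d ε H → containsCopy G H) := by
  have hmn : m ≤ n := by nlinarith
  have hKam : a * K ≤ m := by nlinarith
  have ham : 3 * a ≤ m := by nlinarith
  obtain ⟨R, hRc, hRd⟩ := exists_R n a K (by nlinarith)
  have hn1 : (1 : ℝ) ≤ (n : ℝ) + 1 := by linarith [Nat.cast_nonneg (α := ℝ) n]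
  have hβ0 : 0 ≤ β := by rw [hβ]; positivity
  have hβ1 : β ≤ 1 := hβ'.trans (by
    rw [div_le_one (by positivity)]; exact one_le_pow₀ hn1)
  have hβk : ∀ k, 1 ≤ k → β ^ k ≤ β := fun k hk => pow_le_of_le_one hβ0 hβ1 (by omega)
  have hex : ∀ x : Sym2 (Fin n) → Bool, ∃ A : Fin m → Finset (Fin n), Good1 (gr x) d a K R →
      (∀ j, (A j).card = d) ∧
      (∀ i j, i ≠ j → Disjoint (A i) (A j)) ∧
      (∀ j, ∀ u ∈ A j, ∀ v ∈ A j, u ≠ v → (gr x).Adj u v) ∧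
      (∀ j, ∀ r', d ≤ r' → r' < K → Disjoint (A j) (R r')) := by
    intro x
    by_cases h : Good1 (gr x) d a K R
    · obtain ⟨A, hA⟩ := cliques (gr x) d a K m R h hRc hRd (by omega) hKa hn hd d le_rfl
      exact ⟨A, fun _ => hA⟩
    · exact ⟨fun _ => ∅, fun h' => absurd h' h⟩
  choose A hA using hex
  have key := two_round n p q h0 h1 hq (fun G =>
          ∀ H : SimpleGraph (Fin n), inFamilyF n t d ε H → containsCopy G H)
    (fun x => Good1 (gr x) d a K R)
    (fun x y => ∀ l ∈ Finset.Icc 1 a, GoodB (gr y) m (A x) l)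
    (by
      rintro x y hx hy H ⟨W, w1, w2, w3, w4, w5, w6, w7⟩
      obtain ⟨hA1, hA2, hA3, hA4⟩ := hA x hx
      exact embed ht hd hK (gr x) (gr y) H R hx hRc hRd hKa (A x) hA1 hA2 hA3 hA4
        (fun l hl hl' => hy l (Finset.mem_Icc.mpr ⟨hl, hl'⟩)) W w1 w2 (by rw [w3, hm]) w4 w5 w6 w7)
    ((K * a : ℝ) * β + β) (a * β) (by
      have e1 := Pr_union_le h0 h1 (Finset.range K ×ˢ Finset.Icc 1 a)
        (fun rk x => ¬ GoodA (V := Fin n) (gr x) d a rk.2 (fun Z => R rk.1 \ Z)) (K * a : ℝ) β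
        (by rw [Finset.card_product]; simp) hβ0 (by
          rintro ⟨r, k⟩ hrk
          rw [Finset.mem_product, Finset.mem_Icc] at hrk
          refine (Pr_goodA h0 h1 d a k (fun Z => R r \ Z)).trans ?_
          rw [Fintype.card_fin, ← hβ]
          exact hβk k hrk.2.1)
      have e2 : Pr q (fun x => ¬ GoodA (V := Fin n) (gr x) d a a (fun Z => Z)) ≤ β := by
        refine (Pr_goodA h0 h1 d a a (fun Z => Z)).trans ?_
        rw [Fintype.card_fin, ← hβ]
        exact hβk a ha
      refine le_trans (le_trans (Pr_mono h0 h1 ?_) (Pr_or h0 h1 _ _)) (add_le_add e1 e2)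
      intro x hx
      by_contra hcon
      rw [not_or] at hcon
      refine hx ⟨?_, not_not.mp hcon.2⟩
      intro r hr k hk hka
      by_contra hbad
      refine hcon.1 ⟨(r, k), by simp [hr, hk, hka], ?_⟩
      convert hbad)
    (by
      intro x hx
      obtain ⟨hA1, hA2, hA3, hA4⟩ := hA x hx
      have e1 := Pr_union_le h0 h1 (Finset.Icc 1 a)
        (fun l y => ¬ GoodB (gr y) m (A x) l) (a : ℝ) β (by simp) hβ0 (by
          intro l hl
          rw [Finset.mem_Icc] at hl
          refine (Pr_goodB h0 h1 d a m l (A x) (fun j => (hA1 j).le) hd hA2 (by simpa using hmn)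
            (by omega)).trans ?_
          rw [Fintype.card_fin, ← hβ]
          exact hβk l hl.1)
      refine le_trans (Pr_mono h0 h1 ?_) e1
      intro y hy
      push Not at hy
      exact hy)
    (by positivity)
  refine le_trans ?_ key
  have e1 : (K * a : ℝ) ≤ n := by
    have : K * a ≤ n := by rw [mul_comm]; exact hKam.trans hmn
    exact_mod_cast this
  have e2 : (a : ℝ) ≤ n := by
    have : a ≤ n := by omega
    exact_mod_cast this
  have e3 : (K * a : ℝ) * β + β + a * β ≤ (2 * ((n : ℝ) + 1)) * β := by nlinarith
  have e4 : (2 * ((n : ℝ) + 1)) * β ≤ (2 * ((n : ℝ) + 1)) * (1 / ((n : ℝ) + 1) ^ 3) :=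
    mul_le_mul_of_nonneg_left hβ' (by positivity)
  have e5 : (2 * ((n : ℝ) + 1)) * (1 / ((n : ℝ) + 1) ^ 3) ≤ 2 / ((n : ℝ) + 1) := by
    rw [mul_one_div, div_le_div_iff₀ (by positivity) (by positivity)]
    have : ((n : ℝ) + 1) ^ 2 ≤ ((n : ℝ) + 1) ^ 3 := pow_le_pow_right₀ hn1 (by norm_num)
    nlinarith
  linarith

set_option maxHeartbeats 1000000 in
lemma numeric (n t d : ℕ) (ε p q : ℝ) (ht : 1 ≤ t) (hd : 2 ≤ d) (hε : 0 < ε)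
    (hεd : ε < 1 / (2 * (d : ℝ))) (h1 : q ≤ 1) (hpq : p / 2 ≤ q) (hn : 4 ≤ n)
    (hp : 32 ≤ p / (ε⁻¹ * (t : ℝ) * (n : ℝ) ^ (-(1 : ℝ) / (d : ℝ)) * (Real.logb 2 n) ^ 2)) :
    2 * d * ⌊ε * n⌋₊ ≤ n ∧ 1 ≤ ⌊ε * n⌋₊ / (4 * (d + t + 1)) ∧
    ((n : ℝ) + 1) ^ (d + 1) * Real.exp (-(q ^ d * ((⌊ε * n⌋₊ / (4 * (d + t + 1)) : ℕ) : ℝ)))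
      ≤ 1 / ((n : ℝ) + 1) ^ 3 := by
  have hnR : (4 : ℝ) ≤ n := by exact_mod_cast hn
  have hn0 : (0 : ℝ) < n := by linarith
  have htR : (1 : ℝ) ≤ t := by exact_mod_cast ht
  have hdR : (2 : ℝ) ≤ d := by exact_mod_cast hd
  set L := Real.logb 2 n with hL
  have hL2 : 2 ≤ L := by
    rw [hL, Real.le_logb_iff_rpow_le (by norm_num) hn0]
    norm_num; exact hn
  set z := (n : ℝ) ^ (-(1 : ℝ) / (d : ℝ)) with hz
  have hz0 : 0 < z := Real.rpow_pos_of_pos hn0 _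
  have hzd : z ^ d = (n : ℝ)⁻¹ := by
    rw [hz, ← Real.rpow_natCast, ← Real.rpow_mul hn0.le, div_mul_cancel₀ _ (by positivity),
      Real.rpow_neg_one]
  set y := 16 * ε⁻¹ * t * L ^ 2 with hy
  have hεi : 2 * (d : ℝ) ≤ ε⁻¹ := by
    rw [le_inv_comm₀ (by positivity) hε]
    rw [one_div] at hεd
    exact hεd.le
  have hy1 : 32 * d * L ^ 2 ≤ y := by
    have h3 : 2 * (d : ℝ) * 1 ≤ ε⁻¹ * t := mul_le_mul hεi htR (by norm_num) (by positivity)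
    have h4 := mul_le_mul_of_nonneg_right h3 (sq_nonneg L)
    nlinarith
  have hL4 : 4 ≤ L ^ 2 := by nlinarith
  have hy2 : 2 ≤ y := by nlinarith
  have hqy : y * z ≤ q := by
    have hD : 0 < ε⁻¹ * (t : ℝ) * z * L ^ 2 := by positivity
    rw [le_div_iff₀ hD] at hp
    have : y * z = 16 * (ε⁻¹ * (t : ℝ) * z * L ^ 2) := by rw [hy]; ring
    rw [this]; linarith
  have hqd : y ^ d / n ≤ q ^ d := by
    have := pow_le_pow_left₀ (by positivity) hqy d
    rwa [mul_pow, hzd, ← div_eq_mul_inv] at this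
  have hq0 : 0 ≤ q := le_trans (by positivity) hqy
  have hyn : y ^ d ≤ n := by
    have h3 := hqd.trans (pow_le_one₀ hq0 h1)
    rwa [div_le_one hn0] at h3
  have hdL : (d : ℝ) ≤ L := by
    rw [hL, Real.le_logb_iff_rpow_le (by norm_num) hn0, Real.rpow_natCast]
    exact (pow_le_pow_left₀ (by norm_num) hy2 d).trans hyn
  -- lower bound for ε y^d
  have hεy : ε * y = 16 * t * L ^ 2 := by
    rw [hy]; field_simp
  have hmain : 512 * (t * d) * L ^ 4 ≤ ε * y ^ d := by
    have h3 : y ^ 2 ≤ y ^ d := pow_le_pow_right₀ (by linarith) hd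
    have h4 : ε * y ^ 2 ≤ ε * y ^ d := mul_le_mul_of_nonneg_left h3 hε.le
    have h5 : ε * y ^ 2 = 16 * t * L ^ 2 * y := by rw [← hεy]; ring
    have h6 : 16 * t * L ^ 2 * (32 * d * L ^ 2) ≤ 16 * t * L ^ 2 * y :=
      mul_le_mul_of_nonneg_left hy1 (by positivity)
    nlinarith
  have htd : (1:ℝ) ≤ t * d := by nlinarith
  have hεn : 512 * (t * d) * L ^ 4 ≤ ε * n :=
    hmain.trans (mul_le_mul_of_nonneg_left hyn hε.le)
  have hL16 : 1 ≤ L ^ 4 := one_le_pow₀ (by linarith)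
  have hεn1 : 512 * (t * d) ≤ ε * n := by nlinarith
  set m := ⌊ε * n⌋₊ with hm
  have hm1 : (m : ℝ) ≤ ε * n := Nat.floor_le (by positivity)
  have hm2 : ε * n < m + 1 := Nat.lt_floor_add_one _
  set a := m / (4 * (d + t + 1)) with ha
  have hKtd : d + t + 1 ≤ 2 * (t * d) := by
    obtain ⟨d', rfl⟩ : ∃ d', d = d' + 2 := ⟨d - 2, by omega⟩
    obtain ⟨t', rfl⟩ : ∃ t', t = t' + 1 := ⟨t - 1, by omega⟩
    ring_nf
    nlinarith [Nat.zero_le (t' * d')]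
  have ham : m < 8 * (t * d) * (a + 1) := by
    have h3 : m < 4 * (d + t + 1) * (a + 1) := by
      have := Nat.lt_mul_div_succ m (show 0 < 4 * (d + t + 1) by omega)
      exact this
    exact h3.trans_le (Nat.mul_le_mul_right _ (by omega))
  have hamR : (m : ℝ) < 8 * (t * d) * (a + 1) := by exact_mod_cast ham
  have haR : ε * n ≤ 32 * (t * d) * a := by
    have e : 8 * ((t : ℝ) * d) * (a + 1) = 8 * (t * d * a) + 8 * (t * d) := by ring
    have e' : 32 * ((t : ℝ) * d) * a = 32 * (t * d * a) := by ring
    rw [e] at hamR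
    rw [e']
    linarith
  have ha1 : 1 ≤ a := by
    by_contra h
    have : a = 0 := Nat.eq_zero_of_not_pos h
    rw [this] at haR
    simp at haR
    nlinarith
  refine ⟨?_, ha1, ?_⟩
  · have : 2 * (d : ℝ) * m ≤ n := by
      have h3 : 2 * (d : ℝ) * m ≤ 2 * d * (ε * n) := mul_le_mul_of_nonneg_left hm1 (by positivity)
      have h4 : 2 * (d : ℝ) * ε ≤ 1 := by
        rw [lt_div_iff₀ (by positivity)] at hεd
        linarith
      nlinarith
    exact_mod_cast this
  · have hQa : 16 * L ^ 4 ≤ q ^ d * a := by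
      have h3 : y ^ d / n * a ≤ q ^ d * a := mul_le_mul_of_nonneg_right hqd (by positivity)
      refine le_trans ?_ h3
      rw [div_mul_eq_mul_div, le_div_iff₀ hn0]
      have h4 : y ^ d * (ε * n) ≤ y ^ d * (32 * (t * d) * a) :=
        mul_le_mul_of_nonneg_left haR (by positivity)
      have h5 : 512 * (t * d) * L ^ 4 * n ≤ ε * y ^ d * n :=
        mul_le_mul_of_nonneg_right hmain hn0.le
      have h6 : (32 * (t * d : ℝ)) * (16 * L ^ 4 * n) ≤ (32 * (t * d)) * (y ^ d * a) := by
        nlinarith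
      exact le_of_mul_le_mul_left h6 (by positivity)
    have hlog : Real.log ((n : ℝ) + 1) ≤ 2 * L := by
      have h3 : Real.log ((n : ℝ) + 1) ≤ Real.log ((n : ℝ) ^ 2) :=
        Real.log_le_log (by positivity) (by nlinarith)
      rw [Real.log_pow] at h3
      have h4 : Real.log n = L * Real.log 2 := by
        rw [hL, Real.logb, div_mul_cancel₀ _ (Real.log_pos (by norm_num)).ne']
      have h5 : Real.log 2 ≤ 1 := by
        have := Real.log_two_lt_d9; linarith
      rw [h4] at h3
      push_cast at h3
      nlinarith
    have hlog0 : 0 ≤ Real.log ((n : ℝ) + 1) := Real.log_nonneg (by linarith)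
    have hfin : ((d : ℝ) + 4) * Real.log ((n : ℝ) + 1) ≤ q ^ d * a := by
      refine le_trans ?_ hQa
      calc ((d : ℝ) + 4) * Real.log ((n : ℝ) + 1) ≤ (3 * L) * (2 * L) :=
            mul_le_mul (by linarith) hlog hlog0 (by linarith)
        _ ≤ 16 * L ^ 4 := by nlinarith
    have hpos : (0:ℝ) < (n : ℝ) + 1 := by linarith
    rw [le_div_iff₀ (by positivity)]
    have h7 : ((n : ℝ) + 1) ^ (d + 1) * Real.exp (-(q ^ d * a)) * ((n : ℝ) + 1) ^ 3
        = Real.exp (((d : ℝ) + 4) * Real.log ((n : ℝ) + 1) - q ^ d * a) := by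
      rw [sub_eq_add_neg, Real.exp_add]
      have h8 : Real.exp (((d : ℝ) + 4) * Real.log ((n : ℝ) + 1)) = ((n : ℝ) + 1) ^ (d + 4) := by
        have := Real.exp_nat_mul (Real.log ((n : ℝ) + 1)) (d + 4)
        rw [Real.exp_log hpos] at this
        rw [← this]; push_cast; rfl
      rw [h8]; ring
    rw [h7]
    exact Real.exp_le_one_iff.mpr (by linarith)

/-- Universality of `G(n,p)` for the family `𝓕(n, t, ε, d)` (Ferber–Nenadov–Peter). -/
theorem universality_partitionable
    (t d : ℕ → ℕ) (ht : ∀ n, 1 ≤ t n) (hd : ∀ n, 2 ≤ d n)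
    (ε : ℕ → ℝ) (hε : ∀ n, 0 < ε n) (hεd : ∀ n, ε n < 1 / (2 * (d n : ℝ)))
    (p : ℕ → ℝ) (hp : ∀ n, 0 ≤ p n ∧ p n ≤ 1)
    (hgrow : Tendsto
      (fun n : ℕ => p n /
        ((ε n)⁻¹ * (t n : ℝ) * (n : ℝ) ^ (-(1 : ℝ) / (d n : ℝ)) * (Real.logb 2 n) ^ 2))
      atTop atTop) :
    Tendsto (fun n : ℕ =>
        gnpProb n (p n) (fun G =>
          ∀ H : SimpleGraph (Fin n), inFamilyF n (t n) (d n) (ε n) H → containsCopy G H))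
      atTop (nhds 1) := by
  have h2 : Tendsto (fun n : ℕ => 1 - 2 / ((n : ℝ) + 1)) atTop (nhds 1) := by
    have h3 : Tendsto (fun n : ℕ => (n : ℝ) + 1) atTop atTop :=
      tendsto_atTop_add_const_right _ _ tendsto_natCast_atTop_atTop
    have h4 := (h3.const_div_atTop (2 : ℝ)).const_sub 1
    simpa using h4
  have hq : ∀ n, ∃ q : ℝ, 0 ≤ q ∧ q ≤ 1 ∧ (1 - q) ^ 2 = 1 - p n ∧ p n / 2 ≤ q := by
    intro n
    obtain ⟨h0, h1⟩ := hp n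
    have hs := Real.sq_sqrt (show 0 ≤ 1 - p n by linarith)
    have hs0 := Real.sqrt_nonneg (1 - p n)
    refine ⟨1 - Real.sqrt (1 - p n), ?_, by linarith, by rw [sub_sub_cancel, hs], ?_⟩
    · nlinarith
    · nlinarith [sq_nonneg (1 - Real.sqrt (1 - p n))]
  refine tendsto_of_tendsto_of_tendsto_of_le_of_le' h2 tendsto_const_nhds ?_ ?_
  · filter_upwards [hgrow.eventually_ge_atTop 32, eventually_ge_atTop 4] with n hn hn4
    obtain ⟨q, q0, q1, q2, q3⟩ := hq n
    obtain ⟨e1, e2, e3⟩ := numeric n (t n) (d n) (ε n) (p n) q (ht n) (hd n) (hε n) (hεd n)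
      q1 q3 hn4 hn
    refine main_n n (t n) (d n) (⌊ε n * n⌋₊ / (4 * (d n + t n + 1))) ⌊ε n * n⌋₊ (d n + t n + 1)
      (ε n) (p n) q _ (ht n) (hd n) rfl rfl ?_ e1 q0 q1 q2 rfl e3 e2
    have := Nat.div_mul_le_self ⌊ε n * n⌋₊ (4 * (d n + t n + 1))
    calc _ = ⌊ε n * n⌋₊ / (4 * (d n + t n + 1)) * (4 * (d n + t n + 1)) := by ring
      _ ≤ _ := this
  · filter_upwards with n
    obtain ⟨q, q0, q1, q2, q3⟩ := hq n
    exact gnpProb_le_one n (p n) q q0 q1 q2 _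
end

section
/- (Aharoni–Haxell.) Let g and t be positive integers and let H_1, …, H_t be g-uniform hypergraphs on the same vertex set. Suppose that for every subset I ⊆ {1, …, t}, the hypergraph ∪_{i ∈ I} H_i (the hypergraph whose edge set is the union of the edge sets of the H_i, i ∈ I) contains a matching of size greater than g(|I| − 1). Then there exists a function f : {1, …, t} → ∪_{i=1}^t E(H_i) such that f(i) ∈ E(H_i) for every i and f(i) ∩ f(j) = ∅ whenever i ≠ j. -/
open Finset

namespace AHHall

variable {β : Type*} [Fintype β] [DecidableEq β]

/-- Mod 2 simplicial boundary. -/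
def bd (c : Finset β → ZMod 2) (τ : Finset β) : ZMod 2 := ∑ x ∈ τᶜ, c (insert x τ)

/-- Cone over a chain with apex `v`. -/
def cone (v : β) (u : Finset β → ZMod 2) (σ : Finset β) : ZMod 2 :=
  if v ∈ σ then u (σ.erase v) else 0

/-- The chain `c` is supported on `R`-cliques inside `S` with at most `k` vertices. -/
def Supp (R : β → β → Prop) (S : Finset β) (k : ℕ) (c : Finset β → ZMod 2) : Prop :=
  ∀ σ, c σ ≠ 0 → σ ⊆ S ∧ (∀ x ∈ σ, ∀ y ∈ σ, x ≠ y → R x y) ∧ σ.card ≤ k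

lemma bd_add (a b : Finset β → ZMod 2) (τ : Finset β) :
    bd (fun σ => a σ + b σ) τ = bd a τ + bd b τ := by
  simp [bd, Finset.sum_add_distrib]

lemma bd_sum {ι : Type*} (I : Finset ι) (a : ι → Finset β → ZMod 2) (τ : Finset β) :
    bd (fun σ => ∑ i ∈ I, a i σ) τ = ∑ i ∈ I, bd (a i) τ := by
  simp only [bd]; exact Finset.sum_comm

/-- Split the boundary at a vertex. -/
lemma bd_split (v : β) (c : Finset β → ZMod 2) (τ : Finset β) (hv : v ∉ τ) :
    bd c τ = c (insert v τ) + ∑ x ∈ (insert v τ)ᶜ, c (insert x τ) := by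
  have : τᶜ = insert v (insert v τ)ᶜ := by
    ext x; by_cases h : x = v <;> simp [h, hv]
  rw [bd, this, Finset.sum_insert (by simp)]

lemma bd_cone (v : β) (u : Finset β → ZMod 2) (hu : ∀ σ, v ∈ σ → u σ = 0) (τ : Finset β) :
    bd (cone v u) τ = if v ∈ τ then bd u (τ.erase v) else u τ := by
  split_ifs with h
  · rw [bd_split v u (τ.erase v) (by simp), hu _ (by simp), zero_add, Finset.insert_erase h, bd]
    apply Finset.sum_congr rfl
    intro x hx
    have hxv : x ≠ v := by rintro rfl; simp [h] at hx
    rw [cone, if_pos (by simp [h]), Finset.erase_insert_of_ne hxv]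
  · rw [bd_split v _ τ h, Finset.sum_eq_zero, add_zero, cone, if_pos (by simp),
      Finset.erase_insert h]
    intro x hx
    have hxv : v ≠ x := by rintro rfl; simp at hx
    rw [cone, if_neg (by simp [h, hxv])]

/-- The part of a chain avoiding `v`. -/
def away (v : β) (z : Finset β → ZMod 2) (σ : Finset β) : ZMod 2 :=
  if v ∈ σ then 0 else z σ

/-- The link part of a chain at `v`. -/
def link (v : β) (z : Finset β → ZMod 2) (σ : Finset β) : ZMod 2 :=
  if v ∈ σ then 0 else z (insert v σ)

lemma z2 (a b : ZMod 2) (h : a + b = 0) : a = b := by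
  revert a b; decide

lemma z2self (a : ZMod 2) : a + a = 0 := by
  revert a; decide

lemma bd_away (v : β) (z : Finset β → ZMod 2) (hz : ∀ τ, bd z τ = 0) (τ : Finset β) :
    bd (away v z) τ = link v z τ := by
  rw [link]
  split_ifs with h
  · rw [bd]; apply Finset.sum_eq_zero; intro x _; simp [away, h]
  · have h1 := bd_split v z τ h
    rw [hz] at h1
    rw [bd_split v _ τ h]
    have : ∑ x ∈ (insert v τ)ᶜ, away v z (insert x τ) = ∑ x ∈ (insert v τ)ᶜ, z (insert x τ) := by
      apply Finset.sum_congr rfl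
      intro x hx
      have hxv : v ≠ x := by rintro rfl; simp at hx
      rw [away, if_neg (by simp [h, hxv])]
    rw [this, away, if_pos (by simp), zero_add]
    exact (z2 _ _ h1.symm).symm

lemma bd_link (v : β) (z : Finset β → ZMod 2) (hz : ∀ τ, bd z τ = 0) (τ : Finset β) :
    bd (link v z) τ = 0 := by
  by_cases h : v ∈ τ
  · rw [bd]; apply Finset.sum_eq_zero; intro x _; simp [link, h]
  · rw [bd_split v _ τ h, link, if_pos (by simp), zero_add]
    rw [← hz (insert v τ), bd]
    apply Finset.sum_congr rfl
    intro x hx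
    have hxv : v ≠ x := by rintro rfl; simp at hx
    rw [link, if_neg (by simp [h, hxv]), Finset.insert_comm]

/-- `∂(v * u)` when `∂ u` is the link of the cycle `z`. -/
lemma bd_cone_fill (v : β) (z u : Finset β → ZMod 2) (hu : ∀ σ, v ∈ σ → u σ = 0)
    (h : ∀ τ, bd u τ = link v z τ) (τ : Finset β) :
    bd (cone v u) τ = if v ∈ τ then z τ else u τ := by
  rw [bd_cone v u hu]
  split_ifs with hv
  · rw [h, link, if_neg (by simp), Finset.insert_erase hv]
  · rfl

lemma fill (R : β → β → Prop) (hs : ∀ x y, R x y → R y x) (g : ℕ)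
    (hdeg : ∀ M : Finset β, (∀ x ∈ M, ∀ y ∈ M, x ≠ y → R x y) →
      ∀ v, v ∉ M → ∃ B ⊆ M, B.card ≤ g ∧ ∀ m ∈ M, m ∉ B → R v m) :
    ∀ (n : ℕ) (S M : Finset β) (k : ℕ) (z : Finset β → ZMod 2), S.card ≤ n → M ⊆ S →
      (∀ x ∈ M, ∀ y ∈ M, x ≠ y → R x y) → g * (k + 1) < M.card + g →
      Supp R S k z → (∀ τ, bd z τ = 0) →
      ∃ c, Supp R S (k + 1) c ∧ ∀ τ, bd c τ = z τ := by
  classical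
  intro n
  induction n with
  | zero =>
    intro S M k z hS hM _ hk
    have := Finset.card_le_card hM
    have : M.card = 0 := by omega
    rw [this] at hk
    nlinarith [Nat.zero_le (g * k)]
  | succ n ih =>
    intro S M k z hS hM hMR hk hz hzc
    by_cases hMS : M = S
    · subst hMS
      have hpos : M.Nonempty := by
        rw [← Finset.card_pos]; nlinarith [Nat.zero_le (g * k)]
      obtain ⟨v, hv⟩ := hpos
      have hu : ∀ σ, v ∈ σ → away v z σ = 0 := by intro σ h; simp [away, h]
      refine ⟨cone v (away v z), ?_, ?_⟩
      · intro σ hσ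
        have hvσ : v ∈ σ := by by_contra h; simp [cone, h] at hσ
        simp [cone, hvσ, away] at hσ
        obtain ⟨h1, h2, h3⟩ := hz _ hσ
        have h4 : σ ⊆ M := by
          rw [← Finset.insert_erase hvσ]; exact Finset.insert_subset hv h1
        refine ⟨h4, fun x hx y hy => hMR x (h4 hx) y (h4 hy), ?_⟩
        rw [Finset.card_erase_of_mem hvσ] at h3; omega
      · intro τ
        rw [bd_cone_fill v z _ hu (bd_away v z hzc)]
        split_ifs with h
        · rfl
        · simp [away, h]
    · obtain ⟨v, hvS, hvM⟩ := Finset.exists_of_ssubset (Finset.ssubset_iff_subset_ne.2 ⟨hM, hMS⟩)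
      -- link filling
      set S' := (S.erase v).filter (fun x => R v x) with hS'
      have hcardS' : S'.card ≤ n := by
        have := Finset.card_filter_le (S.erase v) (fun x => R v x)
        rw [Finset.card_erase_of_mem hvS] at this
        rw [hS']
        exact this.trans (by omega)
      obtain ⟨u, hu, hub⟩ : ∃ u, Supp R S' k u ∧ ∀ τ, bd u τ = link v z τ := by
        cases k with
        | zero =>
          have hl : ∀ σ, link v z σ = 0 := by
            intro σ
            rw [link]
            split_ifs with h
            · rfl
            · by_contra h'
              have := (hz _ h').2.2
              rw [Finset.card_insert_of_notMem h] at this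
              omega
          refine ⟨fun _ => 0, fun σ h => absurd rfl h, fun τ => ?_⟩
          rw [hl]; simp [bd]
        | succ k =>
          obtain ⟨B, hBM, hBg, hB⟩ := hdeg M hMR v hvM
          refine ih S' (M \ B) k (link v z) hcardS' ?_ ?_ ?_ ?_ (bd_link v z hzc)
          · intro m hm
            rw [Finset.mem_sdiff] at hm
            simp only [hS', Finset.mem_filter, Finset.mem_erase]
            exact ⟨⟨fun h => hvM (h ▸ hm.1), hM hm.1⟩, hB m hm.1 hm.2⟩
          · intro x hx y hy
            exact hMR x (Finset.mem_sdiff.1 hx).1 y (Finset.mem_sdiff.1 hy).1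
          · have := Finset.card_sdiff_add_card_eq_card hBM
            nlinarith
          · intro σ hσ
            have hvσ : v ∉ σ := by intro h; simp [link, h] at hσ
            simp only [link, hvσ, if_false] at hσ
            obtain ⟨h1, h2, h3⟩ := hz _ hσ
            rw [Finset.card_insert_of_notMem hvσ] at h3
            refine ⟨?_, fun x hx y hy => h2 x (by simp [hx]) y (by simp [hy]), by omega⟩
            intro x hx
            have hxv : x ≠ v := fun h => hvσ (h ▸ hx)
            simp only [hS', Finset.mem_filter, Finset.mem_erase]
            exact ⟨⟨hxv, h1 (by simp [hx])⟩, h2 v (by simp) x (by simp [hx]) hxv.symm⟩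
      have hu0 : ∀ σ, v ∈ σ → u σ = 0 := by
        intro σ h
        by_contra h'
        have := (hu σ h').1 h
        simp [hS'] at this
      -- rest
      obtain ⟨c, hc, hcb⟩ := ih (S.erase v) M k (fun σ => away v z σ + u σ)
        (by rw [Finset.card_erase_of_mem hvS]; omega)
        (fun x hx => Finset.mem_erase.2 ⟨fun h => hvM (h ▸ hx), hM hx⟩) hMR hk
        (by
          intro σ hσ
          by_cases h : u σ = 0
          · replace hσ : away v z σ + u σ ≠ 0 := hσ
            rw [h, add_zero] at hσ
            have hvσ : v ∉ σ := by intro h; simp [away, h] at hσ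
            simp only [away, hvσ, if_false] at hσ
            obtain ⟨h1, h2, h3⟩ := hz _ hσ
            exact ⟨fun x hx => Finset.mem_erase.2 ⟨fun h => hvσ (h ▸ hx), h1 hx⟩, h2, h3⟩
          · obtain ⟨h1, h2, h3⟩ := hu _ h
            exact ⟨h1.trans (Finset.filter_subset _ _), h2, h3⟩)
        (by
          intro τ
          rw [bd_add, bd_away v z hzc, hub, z2self])
      refine ⟨fun σ => c σ + cone v u σ, ?_, ?_⟩
      · intro σ hσ
        by_cases h : c σ = 0
        · replace hσ : c σ + cone v u σ ≠ 0 := hσ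
          rw [h, zero_add] at hσ
          have hvσ : v ∈ σ := by by_contra h; simp [cone, h] at hσ
          simp only [cone, hvσ, if_true] at hσ
          obtain ⟨h1, h2, h3⟩ := hu _ hσ
          rw [Finset.card_erase_of_mem hvσ] at h3
          have key : ∀ x ∈ σ, x ≠ v → x ∈ S ∧ R v x := by
            intro x hx hxv
            have := h1 (Finset.mem_erase.2 ⟨hxv, hx⟩)
            simp only [hS', Finset.mem_filter, Finset.mem_erase] at this
            exact ⟨this.1.2, this.2⟩
          refine ⟨?_, ?_, by omega⟩
          · intro x hx
            by_cases hxv : x = v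
            · rw [hxv]; exact hvS
            · exact (key x hx hxv).1
          · intro x hx y hy hxy
            by_cases hxv : x = v
            · subst hxv; exact (key y hy hxy.symm).2
            · by_cases hyv : y = v
              · subst hyv; exact hs _ _ (key x hx hxv).2
              · exact h2 x (Finset.mem_erase.2 ⟨hxv, hx⟩) y (Finset.mem_erase.2 ⟨hyv, hy⟩) hxy
        · obtain ⟨h1, h2, h3⟩ := hc _ h
          exact ⟨h1.trans (Finset.erase_subset _ _), h2, h3⟩
      · intro τ
        rw [bd_add, hcb, bd_cone_fill v z u hu0 hub]
        split_ifs with h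
        · simp [away, h, hu0 τ h]
        · simp only [away, h, if_false]
          rw [add_assoc, z2self, add_zero]

section
variable {ι : Type*} [DecidableEq ι]

/-- `σ` is a rainbow set for the colour set `I`. -/
def Rb (col : β → ι) (I : Finset ι) (σ : Finset β) : Prop :=
  σ.image col = I ∧ σ.card = I.card

lemma Rb.inj {col : β → ι} {I : Finset ι} {σ : Finset β} (h : Rb col I σ) :
    ∀ x ∈ σ, ∀ y ∈ σ, col x = col y → x = y := by
  have h2 := h.2
  rw [← h.1] at h2
  have := Finset.card_image_iff.1 h2.symm
  intro x hx y hy hxy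
  exact this hx hy hxy

open Classical in
lemma count (col : β → ι) (I : Finset ι) (i : ι) (hi : i ∈ I) (σ : Finset β)
    (hσ : ∀ x ∈ σ, col x ∈ I) :
    (((σ.filter (fun x => Rb col (I.erase i) (σ.erase x))).card : ℕ) : ZMod 2)
      = if Rb col I σ then 1 else 0 := by
  split_ifs with h
  · obtain ⟨x, hx, hxi⟩ : ∃ x ∈ σ, col x = i := by
      have : i ∈ σ.image col := by rw [h.1]; exact hi
      simpa using this
    have : σ.filter (fun x => Rb col (I.erase i) (σ.erase x)) = {x} := by
      ext y
      simp only [Finset.mem_filter, Finset.mem_singleton]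
      constructor
      · rintro ⟨hy, hr⟩
        by_contra hne
        have : col x ∈ (σ.erase y).image col :=
          Finset.mem_image_of_mem _ (Finset.mem_erase.2 ⟨fun h => hne h.symm, hx⟩)
        rw [hr.1, hxi] at this
        simp at this
      · rintro rfl
        refine ⟨hx, ?_, ?_⟩
        · ext j
          simp only [Finset.mem_image, Finset.mem_erase]
          constructor
          · rintro ⟨w, ⟨hw, hwσ⟩, rfl⟩
            exact ⟨fun h' => hw (h.inj w hwσ y hx (h'.trans hxi.symm)), hσ w hwσ⟩
          · rintro ⟨hj, hjI⟩
            rw [← h.1] at hjI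
            obtain ⟨w, hw, rfl⟩ := Finset.mem_image.1 hjI
            exact ⟨w, ⟨fun h' => hj (h' ▸ hxi), hw⟩, rfl⟩
        · rw [Finset.card_erase_of_mem hx, Finset.card_erase_of_mem hi, h.2]
    rw [this]; simp
  · by_cases hne : (σ.filter (fun x => Rb col (I.erase i) (σ.erase x))).Nonempty
    · obtain ⟨x, hx⟩ := hne
      rw [Finset.mem_filter] at hx
      obtain ⟨hx, hr⟩ := hx
      have hcI : σ.card = I.card := by
        have := hr.2
        rw [Finset.card_erase_of_mem hx, Finset.card_erase_of_mem hi] at this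
        have := Finset.card_pos.2 ⟨x, hx⟩
        have := Finset.card_pos.2 ⟨i, hi⟩
        omega
      have hxi : col x ≠ i := by
        intro hxi
        apply h
        refine ⟨?_, hcI⟩
        rw [← Finset.insert_erase hx, Finset.image_insert, hr.1, hxi, Finset.insert_erase hi]
      obtain ⟨y, hy, hyx⟩ : ∃ y ∈ σ.erase x, col y = col x := by
        have : col x ∈ (σ.erase x).image col := by
          rw [hr.1]; exact Finset.mem_erase.2 ⟨hxi, hσ x hx⟩
        simpa only [Finset.mem_image] using this
      have hyσ := (Finset.mem_erase.1 hy).2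
      have hyne := (Finset.mem_erase.1 hy).1
      have : σ.filter (fun x => Rb col (I.erase i) (σ.erase x)) = {x, y} := by
        ext w
        simp only [Finset.mem_filter, Finset.mem_singleton, Finset.mem_insert]
        constructor
        · rintro ⟨hw, hwr⟩
          by_contra hcon
          push Not at hcon
          exact hyne (hwr.inj y (Finset.mem_erase.2 ⟨hcon.2.symm, hyσ⟩) x
            (Finset.mem_erase.2 ⟨hcon.1.symm, hx⟩) hyx)
        · rintro (rfl | rfl)
          · exact ⟨hx, hr⟩
          · refine ⟨hyσ, ?_, ?_⟩
            · rw [← hr.1]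
              ext j
              simp only [Finset.mem_image, Finset.mem_erase]
              constructor
              · rintro ⟨a, ⟨ha, haσ⟩, rfl⟩
                by_cases hax : a = x
                · exact ⟨w, ⟨hyne, hyσ⟩, by rw [hyx, hax]⟩
                · exact ⟨a, ⟨hax, haσ⟩, rfl⟩
              · rintro ⟨a, ⟨ha, haσ⟩, rfl⟩
                by_cases hax : a = w
                · exact ⟨x, ⟨hyne.symm, hx⟩, by rw [hax, hyx]⟩
                · exact ⟨a, ⟨hax, haσ⟩, rfl⟩
            · rw [Finset.card_erase_of_mem hyσ, ← hr.2, Finset.card_erase_of_mem hx]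
      rw [this, Finset.card_pair hyne.symm]
      rfl
    · rw [Finset.not_nonempty_iff_eq_empty] at hne
      rw [hne]; simp

open Classical in
/-- Double counting of the boundary. -/
lemma bd_count (P : Finset β → Prop) (c : Finset β → ZMod 2) :
    ∑ τ, (if P τ then bd c τ else 0)
      = ∑ σ, c σ * ((σ.filter (fun x => P (σ.erase x))).card : ZMod 2) := by
  have h1 : ∀ τ, (if P τ then bd c τ else 0)
      = ∑ x ∈ τᶜ, (if P τ then c (insert x τ) else 0) := by
    intro τ; split_ifs <;> simp [bd]
  have h2 : ∀ σ, c σ * ((σ.filter (fun x => P (σ.erase x))).card : ZMod 2)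
      = ∑ x ∈ σ, (if P (σ.erase x) then c σ else 0) := by
    intro σ
    rw [← Finset.sum_filter, Finset.sum_const, nsmul_eq_mul, mul_comm]
  simp_rw [h1, h2]
  rw [Finset.sum_sigma', Finset.sum_sigma']
  refine Finset.sum_bij' (fun p _ => ⟨insert p.2 p.1, p.2⟩) (fun p _ => ⟨p.1.erase p.2, p.2⟩)
    ?_ ?_ ?_ ?_ ?_
  · rintro ⟨τ, x⟩ h; simp
  · rintro ⟨τ, x⟩ h; simp
  · rintro ⟨τ, x⟩ h
    have : x ∉ τ := by simpa using h
    simp [this]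
  · rintro ⟨τ, x⟩ h
    have : x ∈ τ := by simpa using h
    simp [this]
  · rintro ⟨τ, x⟩ h
    have : x ∉ τ := by simpa using h
    simp [this]

open Classical in
lemma sperner (col : β → ι) (c : Finset ι → Finset β → ZMod 2)
    (h0 : ∀ σ, c ∅ σ = if σ = ∅ then 1 else 0)
    (hcol : ∀ I σ, c I σ ≠ 0 → ∀ x ∈ σ, col x ∈ I)
    (hb : ∀ I τ, I.Nonempty → bd (c I) τ = ∑ i ∈ I, c (I.erase i) τ) (I : Finset ι) :
    ∑ σ, (if Rb col I σ then c I σ else 0) = 1 := by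
  induction I using Finset.induction_on with
  | empty =>
    rw [Finset.sum_eq_single ∅]
    · simp [Rb, h0]
    · intro σ _ hσ; simp [h0, hσ]
    · simp
  | insert i J hi ih =>
    set I := insert i J with hI
    have hiI : i ∈ I := by simp [hI]
    have hJ : I.erase i = J := by simp [hI, hi]
    have key := bd_count (Rb col J) (c I)
    have e1 : ∀ τ, (if Rb col J τ then bd (c I) τ else 0) = if Rb col J τ then c J τ else 0 := by
      intro τ
      split_ifs with h
      · rw [hb I τ ⟨i, hiI⟩, Finset.sum_eq_single i, hJ]
        · intro j hj hji
          by_contra hne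
          have hjJ : j ∈ J := by
            rw [← hJ]; exact Finset.mem_erase.2 ⟨hji, hj⟩
          rw [← h.1] at hjJ
          obtain ⟨x, hx, hxj⟩ := Finset.mem_image.1 hjJ
          have := hcol _ _ hne x hx
          rw [hxj] at this
          simp at this
        · intro h; exact absurd hiI h
      · rfl
    simp_rw [e1] at key
    rw [ih] at key
    rw [key]
    apply Finset.sum_congr rfl
    intro σ _
    by_cases hne : c I σ = 0
    · simp [hne]
    · have := count col I i hiI σ (hcol I σ hne)
      rw [hJ] at this
      rw [this]; simp

/-- Existence of the chain map from the simplex. -/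
lemma exists_chain (R : β → β → Prop) (col : β → ι) [Fintype ι]
    (hfill : ∀ (I : Finset ι) (k : ℕ) (z : Finset β → ZMod 2), I.card = k + 1 →
      Supp R (univ.filter (fun x => col x ∈ I)) k z → (∀ τ, bd z τ = 0) →
      ∃ c, Supp R (univ.filter (fun x => col x ∈ I)) (k + 1) c ∧ ∀ τ, bd c τ = z τ) (n : ℕ) :
    ∃ c : Finset ι → Finset β → ZMod 2, (∀ σ, c ∅ σ = if σ = ∅ then 1 else 0) ∧
      ∀ I, I.card ≤ n → Supp R (univ.filter (fun x => col x ∈ I)) I.card (c I) ∧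
        ∀ τ, bd (c I) τ = ∑ i ∈ I, c (I.erase i) τ := by
  classical
  induction n with
  | zero =>
    refine ⟨fun _ σ => if σ = ∅ then 1 else 0, fun _ => rfl, ?_⟩
    intro I hI
    have : I = ∅ := by simpa using hI
    subst this
    refine ⟨?_, ?_⟩
    · intro σ hσ
      have : σ = ∅ := by by_contra h; simp [h] at hσ
      subst this; simp
    · intro τ; simp [bd]
  | succ n ih =>
    obtain ⟨c, hc0, hc⟩ := ih
    have ex : ∀ I : Finset ι, ∃ d : Finset β → ZMod 2, I.card = n + 1 →
        Supp R (univ.filter (fun x => col x ∈ I)) (n + 1) d ∧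
        ∀ τ, bd d τ = ∑ i ∈ I, c (I.erase i) τ := by
      intro I
      by_cases hI : I.card = n + 1
      · have hcard : ∀ i ∈ I, (I.erase i).card = n := by
          intro i hi; rw [Finset.card_erase_of_mem hi, hI]; rfl
        obtain ⟨d, hd⟩ := hfill I n (fun τ => ∑ i ∈ I, c (I.erase i) τ) hI
          (by
            intro σ hσ
            obtain ⟨i, hi, hne⟩ := Finset.exists_ne_zero_of_sum_ne_zero hσ
            obtain ⟨h1, h2, h3⟩ := (hc (I.erase i) (hcard i hi).le).1 σ hne
            refine ⟨fun x hx => ?_, h2, by rw [hcard i hi] at h3; exact h3⟩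
            have := h1 hx
            simp only [Finset.mem_filter, Finset.mem_erase] at this ⊢
            exact ⟨this.1, this.2.2⟩)
          (by
            intro τ
            rw [bd_sum, Finset.sum_congr rfl
              (fun i hi => (hc (I.erase i) (hcard i hi).le).2 τ), Finset.sum_sigma']
            refine Finset.sum_involution (fun p _ => ⟨p.2, p.1⟩) ?_ ?_ ?_ ?_
            · rintro ⟨i, j⟩ h
              simp only
              rw [Finset.erase_right_comm, z2self]
            · rintro ⟨i, j⟩ h _ heq
              simp at h heq
              exact h.2.1 heq.1
            · rintro ⟨i, j⟩ h
              simp at h ⊢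
              exact ⟨h.2.2, fun h' => h.2.1 h'.symm, h.1⟩
            · rintro ⟨i, j⟩ h; rfl)
        exact ⟨d, fun _ => hd⟩
      · exact ⟨0, fun h => absurd h hI⟩
    choose d hd using ex
    refine ⟨fun I => if I.card = n + 1 then d I else c I, ?_, ?_⟩
    · intro σ; simp [hc0]
    · intro I hI
      have he : ∀ i ∈ I, ∀ τ, (if (I.erase i).card = n + 1 then d (I.erase i) else c (I.erase i)) τ
          = c (I.erase i) τ := by
        intro i hi τ
        rw [if_neg]
        rw [Finset.card_erase_of_mem hi]
        have := Finset.card_pos.2 ⟨i, hi⟩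
        omega
      by_cases h : I.card = n + 1
      · simp only [h, if_true]
        refine ⟨(hd I h).1, fun τ => ?_⟩
        rw [(hd I h).2, Finset.sum_congr rfl (fun i hi => he i hi τ)]
      · simp only [h, if_false]
        obtain ⟨h1, h2⟩ := hc I (by omega)
        refine ⟨h1, fun τ => ?_⟩
        rw [h2, Finset.sum_congr rfl (fun i hi => he i hi τ)]

end

end AHHall

/-- Aharoni–Haxell: a Hall-type criterion for systems of disjoint representatives in
`g`-uniform hypergraphs.  The `i`-th hypergraph has edge set `E i`, a collection of
`g`-element subsets of the common vertex set `α`. -/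
theorem aharoni_haxell_hall
    (g t : ℕ) (hg : 1 ≤ g) (ht : 1 ≤ t) {α : Type*}
    (E : Fin t → Finset (Finset α))
    (hunif : ∀ i, ∀ e ∈ E i, e.card = g)
    (hmatch : ∀ I : Finset (Fin t),
      ∃ M : Finset (Finset α),
        (∀ e ∈ M, ∃ i ∈ I, e ∈ E i) ∧
        (∀ e ∈ M, ∀ e' ∈ M, e ≠ e' → Disjoint e e') ∧
        (g : ℤ) * ((I.card : ℤ) - 1) < (M.card : ℤ)) :
    ∃ f : Fin t → Finset α,
      (∀ i, f i ∈ E i) ∧ ∀ i j, i ≠ j → Disjoint (f i) (f j) := by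
  classical
  let β := (i : Fin t) × {e : Finset α // e ∈ E i}
  let R : β → β → Prop := fun x y => Disjoint x.2.1 y.2.1
  let col : β → Fin t := fun x => x.1
  have hdeg : ∀ M : Finset β, (∀ x ∈ M, ∀ y ∈ M, x ≠ y → R x y) →
      ∀ v, v ∉ M → ∃ B ⊆ M, B.card ≤ g ∧ ∀ m ∈ M, m ∉ B → R v m := by
    intro M hM v _
    refine ⟨M.filter (fun m => ¬ R v m), Finset.filter_subset _ _, ?_, ?_⟩
    · rw [← hunif v.1 v.2.1 v.2.2]
      have hex : ∀ m : β, ∃ a, ¬ R v m → a ∈ v.2.1 ∧ a ∈ m.2.1 := by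
        intro m
        by_cases h : R v m
        · obtain ⟨a, _⟩ : (v.2.1).Nonempty := by
            rw [← Finset.card_pos, hunif v.1 v.2.1 v.2.2]; omega
          exact ⟨a, fun h' => absurd h h'⟩
        · obtain ⟨a, ha⟩ := Finset.not_disjoint_iff.1 h
          exact ⟨a, fun _ => ha⟩
      choose p hp using hex
      refine Finset.card_le_card_of_injOn p ?_ ?_
      · intro m hm
        exact (hp m (Finset.mem_filter.1 hm).2).1
      · intro m hm m' hm' heq
        have hm := Finset.mem_filter.1 hm
        have hm' := Finset.mem_filter.1 hm'
        by_contra hne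
        have hd : Disjoint m.2.1 m'.2.1 := hM m hm.1 m' hm'.1 hne
        have h1 := (hp m hm.2).2
        have h2 := (hp m' hm'.2).2
        rw [← heq] at h2
        exact Finset.disjoint_left.1 hd h1 h2
    · intro m hm hmB
      by_contra h
      exact hmB (Finset.mem_filter.2 ⟨hm, h⟩)
  have hfill : ∀ (I : Finset (Fin t)) (k : ℕ) (z : Finset β → ZMod 2), I.card = k + 1 →
      AHHall.Supp R (univ.filter (fun x => col x ∈ I)) k z → (∀ τ, AHHall.bd z τ = 0) →
      ∃ c, AHHall.Supp R (univ.filter (fun x => col x ∈ I)) (k + 1) c ∧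
        ∀ τ, AHHall.bd c τ = z τ := by
    intro I k z hI hz hzc
    obtain ⟨M, hM1, hM2, hM3⟩ := hmatch I
    have hlift : ∀ e : M, ∃ x : β, x.1 ∈ I ∧ x.2.1 = e.1 := by
      rintro ⟨e, he⟩
      obtain ⟨i, hi, hei⟩ := hM1 e he
      exact ⟨⟨i, e, hei⟩, hi, rfl⟩
    choose q hq1 hq2 using hlift
    have hinj : Function.Injective q := by
      intro a b hab
      apply Subtype.ext
      rw [← hq2 a, ← hq2 b, hab]
    refine AHHall.fill R (fun x y h => Disjoint.symm h) g hdeg _ _ (univ.image q) k z le_rfl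
      ?_ ?_ ?_ hz hzc
    · intro x hx
      obtain ⟨e, _, rfl⟩ := Finset.mem_image.1 hx
      exact Finset.mem_filter.2 ⟨Finset.mem_univ _, hq1 e⟩
    · intro x hx y hy hxy
      obtain ⟨e, _, rfl⟩ := Finset.mem_image.1 hx
      obtain ⟨e', _, rfl⟩ := Finset.mem_image.1 hy
      change Disjoint (q e).2.1 (q e').2.1
      rw [hq2, hq2]
      exact hM2 _ e.2 _ e'.2 (fun h => hxy (by rw [Subtype.ext h]))
    · rw [Finset.card_image_of_injective _ hinj, Finset.card_univ, Fintype.card_coe]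
      rw [hI] at hM3
      push_cast at hM3
      zify
      linarith
  obtain ⟨c, hc0, hc⟩ := AHHall.exists_chain R col hfill t
  have hle : ∀ I : Finset (Fin t), I.card ≤ t := fun I => by
    simpa using Finset.card_le_univ I
  have hsp := AHHall.sperner col c hc0
    (fun I σ hne x hx => (Finset.mem_filter.1 (((hc I (hle I)).1 σ hne).1 hx)).2)
    (fun I τ _ => (hc I (hle I)).2 τ) univ
  obtain ⟨σ, _, hσ⟩ := Finset.exists_ne_zero_of_sum_ne_zero (by rw [hsp]; exact one_ne_zero)
  have hrb : AHHall.Rb col univ σ := by by_contra h; simp [h] at hσ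
  rw [if_pos hrb] at hσ
  have hR := ((hc univ (hle _)).1 σ hσ).2.1
  have hpick : ∀ i, ∃ x ∈ σ, col x = i := by
    intro i
    have : i ∈ σ.image col := by rw [hrb.1]; exact Finset.mem_univ _
    simpa only [Finset.mem_image] using this
  choose x hx hxi using hpick
  refine ⟨fun i => (x i).2.1, ?_, ?_⟩
  · intro i
    have := (x i).2.2
    have h2 : (x i).1 = i := hxi i
    have h3 : E (x i).1 = E i := congrArg E h2
    exact (Finset.ext_iff.1 h3 _).1 this
  · intro i j hij
    exact hR _ (hx i) _ (hx j) (fun h => hij (by rw [← hxi i, ← hxi j, h]))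
end
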